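/- Let S be a finite alphabet with a complementation and let V ⊆ S^d be a polybox code which does not contain a twin pair and has |V| ≤ 9. Then V is rigid: every polybox code W ⊆ S^d equivalent to V is equal to V. -/

import Mathlib

variable {S : Type}

/-- Two words are dichotomous: at some position they carry complementary letters. -/
def Dicho {d : ℕ} (c : S → S) (u v : Fin d → S) : Prop := ∃ j, v j = c (u j)

/-- Two words form a twin pair. -/
def TwinPair {d : ℕ} (c : S → S) (u v : Fin d → S) : Prop :=
  ∃ j, v j = c (u j) ∧ ∀ i, i ≠ j → v i = u i

/-- A polybox code: a set of pairwise dichotomous words. -/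
def PolyboxCode {d : ℕ} (c : S → S) (V : Set (Fin d → S)) : Prop :=
  ∀ u ∈ V, ∀ v ∈ V, u ≠ v → Dicho c u v

/-- The code contains no twin pair. -/
def NoTwinPair {d : ℕ} (c : S → S) (V : Set (Fin d → S)) : Prop :=
  ∀ u ∈ V, ∀ v ∈ V, ¬ TwinPair c u v

/-- `ES`: sets containing exactly one of `s`, `s'` for every letter `s`. -/
def ESet (c : S → S) : Set (Set S) := {B | ∀ s, Xor' (s ∈ B) (c s ∈ B)}

/-- `Es`: members of `ES` containing the letter `s`. -/
def ELetter (c : S → S) (s : S) : Set (Set S) := {B | B ∈ ESet c ∧ s ∈ B}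

/-- The equicomplementary realization `v̌ ⊆ (ES)^d` of a word `v`. -/
def Realize {d : ℕ} (c : S → S) (v : Fin d → S) : Set (Fin d → Set S) :=
  {x | ∀ i, x i ∈ ELetter c (v i)}

/-- The union `⋃_{v ∈ V} v̌`. -/
def RealizeSet {d : ℕ} (c : S → S) (V : Set (Fin d → S)) : Set (Fin d → Set S) :=
  ⋃ v ∈ V, Realize c v

/-- Two codes are equivalent if their realizations coincide. -/
def EquivCodes {d : ℕ} (c : S → S) (V W : Set (Fin d → S)) : Prop :=
  RealizeSet c V = RealizeSet c W

/-- A partition code: a polybox code whose realization is the whole box `(ES)^d`. -/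
def PartitionCode {d : ℕ} (c : S → S) (U : Set (Fin d → S)) : Prop :=
  PolyboxCode c U ∧ RealizeSet c U = {x | ∀ i, x i ∈ ESet c}

/-- `V^{i,l}`: the words of `V` with letter `l` at position `i`. -/
def Subcode {d : ℕ} (V : Set (Fin d → S)) (i : Fin d) (l : S) : Set (Fin d → S) :=
  {v | v ∈ V ∧ v i = l}

/-- A complementation: a fixed-point-free involution. -/
structure IsComplementation (c : S → S) : Prop where
  invol : ∀ s, c (c s) = s
  ne : ∀ s, c s ≠ s

/-- Points of the box `(ES)^d`. -/
abbrev Pt (c : S → S) (d : ℕ) : Type := Fin d → ESet c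

/-- The point `p` lies in the realization of the word `v`. -/
def InBox {d : ℕ} {c : S → S} (v : Fin d → S) (p : Pt c d) : Prop := ∀ i, v i ∈ (p i : Set S)

/-- The point `p` lies in the realization of some word of `A`. -/
def Hit {d : ℕ} {c : S → S} (A : Finset (Fin d → S)) (p : Pt c d) : Prop := ∃ a ∈ A, InBox a p

/-- A twin-free polybox code. -/
structure TwinFreeCode {d : ℕ} (c : S → S) (A : Finset (Fin d → S)) : Prop where
  code : PolyboxCode c (A : Set (Fin d → S))
  noTwin : NoTwinPair c (A : Set (Fin d → S))

/-- Two finite codes have the same realization. -/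
def SameRegion {d : ℕ} (c : S → S) (V W : Finset (Fin d → S)) : Prop :=
  ∀ p : Pt c d, Hit V p ↔ Hit W p

section Letters

variable {c : S → S}

theorem IsComplementation.eq_comm (hc : IsComplementation c) {a b : S} (h : a = c b) : b = c a := by
  rw [h, hc.invol]

theorem IsComplementation.ne_comm (hc : IsComplementation c) {a b : S} (h : a ≠ c b) : b ≠ c a :=
  fun h' => h (hc.eq_comm h')

theorem IsComplementation.inj (hc : IsComplementation c) {a b : S} (h : c a = c b) : a = b := by
  rw [← hc.invol a, h, hc.invol]

theorem compl_notMem (B : ESet c) {a : S} (h : a ∈ (B : Set S)) : c a ∉ (B : Set S) := by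
  rcases B.2 a with h' | h'
  · exact h'.2
  · exact absurd h h'.2

theorem compl_mem (B : ESet c) {a : S} (h : a ∉ (B : Set S)) : c a ∈ (B : Set S) := by
  rcases B.2 a with h' | h'
  · exact absurd h'.1 h
  · exact h'.1

theorem notMem_of_compl (B : ESet c) {a : S}
    (h : c a ∈ (B : Set S)) : a ∉ (B : Set S) := fun h' => compl_notMem B h' h

/-- A set of letters without complementary pairs extends to a member of `ES`. -/
theorem IsComplementation.exists_extend [Finite S] (hc : IsComplementation c) (L : Set S)
    (hL : ∀ s ∈ L, c s ∉ L) : ∃ B : ESet c, L ⊆ (B : Set S) := by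
  obtain ⟨n, ⟨e⟩⟩ := Finite.exists_equiv_fin S
  refine ⟨⟨{s | s ∈ L ∨ (c s ∉ L ∧ e s < e (c s))}, fun s => ?_⟩, fun s hs => Or.inl hs⟩
  have h1 := hL s
  have h2 := hL (c s)
  have h3 : e s ≠ e (c s) := fun h => hc.ne s (e.injective h).symm
  simp only [Set.mem_ofPred_eq, hc.invol] at h2 ⊢
  rcases lt_or_gt_of_ne h3 with h4 | h4
  · have h5 := h4.asymm
    unfold Xor'
    tauto
  · have h5 := h4.asymm
    unfold Xor'
    tauto

theorem IsComplementation.exists_three [Finite S] (hc : IsComplementation c) {a b e : S}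
    (h1 : b ≠ c a) (h2 : e ≠ c a) (h3 : e ≠ c b) :
    ∃ B : ESet c, a ∈ (B : Set S) ∧ b ∈ (B : Set S) ∧ e ∈ (B : Set S) := by
  obtain ⟨B, hB⟩ := hc.exists_extend {a, b, e} (by
    have := hc.ne a
    have := hc.ne b
    have := hc.ne e
    have := hc.ne_comm h1
    have := hc.ne_comm h2
    have := hc.ne_comm h3
    rintro s (rfl | rfl | rfl) <;>
      simp only [Set.mem_insert_iff, Set.mem_singleton_iff, not_or] <;>
      refine ⟨?_, ?_, ?_⟩ <;> first | assumption | (apply Ne.symm; assumption))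
  exact ⟨B, hB (by simp), hB (by simp), hB (by simp)⟩

/-- Exchange `f` for its complement in a member of `ES`. -/
theorem IsComplementation.exists_flip (hc : IsComplementation c) (B : ESet c) (f : S) :
    ∃ B' : ESet c, c f ∈ (B' : Set S) ∧
      ∀ s, s ≠ f → s ≠ c f → (s ∈ (B' : Set S) ↔ s ∈ (B : Set S)) := by
  classical
  refine ⟨⟨{s | if s = f then False else if s = c f then True else s ∈ (B : Set S)},
    fun s => ?_⟩, ?_, ?_⟩
  · have h0 := hc.ne f
    have h1 := B.2 s
    have h2 : c s = f ↔ s = c f := ⟨fun h => hc.eq_comm h.symm, fun h => by rw [h, hc.invol]⟩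
    have h3 : c s = c f ↔ s = f := ⟨hc.inj, fun h => by rw [h]⟩
    simp only [Set.mem_ofPred_eq, h2, h3]
    by_cases h4 : s = f
    · have : f ≠ c f := h0.symm
      simp [h4, Xor', this]
    · by_cases h5 : s = c f
      · simp [h5, Xor', h0]
      · simpa [h4, h5] using h1
  · simp [hc.ne f]
  · intro s h1 h2
    simp [h1, h2]

/-- The complementary member of `ES`. -/
theorem exists_compl (B : ESet c) :
    ∃ B' : ESet c, ∀ s, s ∈ (B' : Set S) ↔ s ∉ (B : Set S) := by
  refine ⟨⟨{s | s ∉ (B : Set S)}, fun s => ?_⟩, fun s => Iff.rfl⟩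
  rcases B.2 s with h | h
  · exact Or.inr ⟨h.2, fun h' => h' h.1⟩
  · exact Or.inl ⟨h.2, fun h' => h' h.1⟩

end Letters

section Points

variable {c : S → S} {d : ℕ}

theorem IsComplementation.dicho_symm (hc : IsComplementation c) {u v : Fin d → S}
    (h : Dicho c u v) : Dicho c v u := by
  obtain ⟨j, hj⟩ := h
  exact ⟨j, hc.eq_comm hj⟩

theorem IsComplementation.compat_symm (hc : IsComplementation c) {u v : Fin d → S}
    (h : ¬ Dicho c u v) : ¬ Dicho c v u := fun h' => h (hc.dicho_symm h')

theorem IsComplementation.compat_self (hc : IsComplementation c) (u : Fin d → S) :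
    ¬ Dicho c u u := fun ⟨_, hj⟩ => hc.ne _ hj.symm

theorem not_dicho_of_inBox {u v : Fin d → S} {p : Pt c d} (hu : InBox u p) (hv : InBox v p) :
    ¬ Dicho c u v := by
  rintro ⟨j, hj⟩
  have h := hv j
  rw [hj] at h
  exact compl_notMem _ (hu j) h

/-- Three pairwise compatible words have a common point. -/
theorem IsComplementation.exists_common [Finite S] (hc : IsComplementation c) {u v w : Fin d → S}
    (h1 : ¬ Dicho c u v) (h2 : ¬ Dicho c u w) (h3 : ¬ Dicho c v w) :
    ∃ p : Pt c d, InBox u p ∧ InBox v p ∧ InBox w p := by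
  have h : ∀ i, ∃ B : ESet c, u i ∈ (B : Set S) ∧ v i ∈ (B : Set S) ∧ w i ∈ (B : Set S) :=
    fun i => hc.exists_three (fun h => h1 ⟨i, h⟩) (fun h => h2 ⟨i, h⟩) (fun h => h3 ⟨i, h⟩)
  choose p hp using h
  exact ⟨p, fun i => (hp i).1, fun i => (hp i).2.1, fun i => (hp i).2.2⟩

theorem IsComplementation.exists_common₂ [Finite S] (hc : IsComplementation c) {u v : Fin d → S}
    (h : ¬ Dicho c u v) : ∃ p : Pt c d, InBox u p ∧ InBox v p := by
  obtain ⟨p, h1, h2, -⟩ := hc.exists_common h h (hc.compat_self v)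
  exact ⟨p, h1, h2⟩

theorem code_unique {A : Finset (Fin d → S)} (hA : PolyboxCode c (A : Set (Fin d → S)))
    {u v : Fin d → S} {p : Pt c d} (hu : u ∈ A) (hv : v ∈ A) (hup : InBox u p)
    (hvp : InBox v p) : u = v := by
  by_contra h
  exact not_dicho_of_inBox hup hvp (hA u (by simpa using hu) v (by simpa using hv) h)

theorem compat_update {u v : Fin d → S} {n : Fin d} {e : S} (h : ¬ Dicho c u v)
    (he : e ≠ c (u n)) : ¬ Dicho c u (Function.update v n e) := by
  rintro ⟨j, hj⟩
  by_cases hjn : j = n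
  · subst hjn
    simp only [Function.update_self] at hj
    exact he hj
  · rw [Function.update_of_ne hjn] at hj
    exact h ⟨j, hj⟩

theorem inBox_update {v : Fin d → S} {p : Pt c d} {i : Fin d} {z : S} :
    InBox (Function.update v i z) p ↔ z ∈ (p i : Set S) ∧ ∀ n, n ≠ i → v n ∈ (p n : Set S) := by
  constructor
  · intro h
    refine ⟨by simpa using h i, fun n hn => ?_⟩
    have := h n
    rwa [Function.update_of_ne hn] at this
  · rintro ⟨h1, h2⟩ n
    by_cases hn : n = i
    · subst hn; simpa using h1
    · rw [Function.update_of_ne hn]; exact h2 n hn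

theorem inBox_update_pt {v : Fin d → S} {p : Pt c d} {i : Fin d} {B : ESet c} :
    InBox v (Function.update p i B) ↔ v i ∈ (B : Set S) ∧ ∀ n, n ≠ i → v n ∈ (p n : Set S) := by
  constructor
  · intro h
    refine ⟨by simpa using h i, fun n hn => ?_⟩
    have := h n
    rwa [Function.update_of_ne hn] at this
  · rintro ⟨h1, h2⟩ n
    by_cases hn : n = i
    · subst hn; simpa using h1
    · rw [Function.update_of_ne hn]; exact h2 n hn

/-- If the part of `x` inside `v` is contained in `y`, then every letter of `y` occurs in `v`
or in `x`. -/
theorem IsComplementation.letter_of_subset [Finite S] (hc : IsComplementation c)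
    {v x y : Fin d → S} (hvx : ¬ Dicho c v x)
    (h : ∀ p : Pt c d, InBox v p → InBox x p → InBox y p) (n : Fin d) :
    y n = v n ∨ y n = x n := by
  by_contra! hn
  have h1 : ¬ Dicho c v (Function.update x n (c (y n))) :=
    compat_update hvx fun h' => hn.1 (hc.inj h')
  have h2 : ¬ Dicho c x (Function.update x n (c (y n))) :=
    compat_update (hc.compat_self x) fun h' => hn.2 (hc.inj h')
  obtain ⟨p, hp1, hp2, hp3⟩ := hc.exists_common hvx h1 h2
  have h3 := hp3 n
  rw [Function.update_self] at h3
  exact compl_notMem _ (h p hp1 hp2 n) h3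

/-- Words with the same nonempty trace on `v` are equal. -/
theorem IsComplementation.eq_of_trace_eq [Finite S] (hc : IsComplementation c)
    {v x y : Fin d → S} (hvx : ¬ Dicho c v x) (hvy : ¬ Dicho c v y)
    (h : ∀ p : Pt c d, InBox v p → (InBox x p ↔ InBox y p)) : x = y := by
  funext n
  have h1 := hc.letter_of_subset hvx (fun p hp hx => (h p hp).1 hx) n
  have h2 := hc.letter_of_subset hvy (fun p hp hx => (h p hp).2 hx) n
  rcases h1 with h1 | h1
  · rcases h2 with h2 | h2
    · rw [h1, h2]
    · exact h2
  · exact h1.symm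

/-- A box which is the disjoint union of two boxes (inside `v`) is cut in halves. -/
theorem IsComplementation.halves [Finite S] (hc : IsComplementation c)
    {v x z w : Fin d → S} (hvx : ¬ Dicho c v x) (hvz : ¬ Dicho c v z) (hvw : ¬ Dicho c v w)
    (hzw : Dicho c z w)
    (h : ∀ p : Pt c d, InBox v p → (InBox x p ↔ InBox z p ∨ InBox w p)) :
    ∃ l, w l = c (z l) ∧ x l = v l ∧ ∀ n, n ≠ l → z n = x n ∧ w n = x n := by
  have hz := hc.letter_of_subset hvz (fun p hp hx => (h p hp).2 (Or.inl hx))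
  have hw := hc.letter_of_subset hvw (fun p hp hx => (h p hp).2 (Or.inr hx))
  obtain ⟨l, hl⟩ := hzw
  have hxl : x l = v l := by
    rcases hz l with h1 | h1
    · exact h1
    · rcases hw l with h2 | h2
      · exact h2
      · rw [h1, hl] at h2
        exact absurd h2.symm (hc.ne _)
  have key : ∀ a b : Fin d → S, ¬ Dicho c v a → b l = c (a l) →
      (∀ n, x n = v n ∨ x n = a n) →
      (∀ p : Pt c d, InBox v p → InBox x p → InBox a p ∨ InBox b p) →
      ∀ n, n ≠ l → a n = x n := by
    intro a b hva hab hxa hcov n hn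
    by_contra hne
    have hxn : x n = v n := (hxa n).resolve_right fun h' => hne h'.symm
    have hal : a l ≠ c (v l) := fun h' => hva ⟨l, h'⟩
    have hcn : c (a n) ≠ c (v n) := fun h' => hne (by rw [hc.inj h', hxn])
    have h1 : ¬ Dicho c v (Function.update (Function.update v l (a l)) n (c (a n))) :=
      compat_update (compat_update (hc.compat_self v) hal) hcn
    have h2 : ¬ Dicho c x (Function.update (Function.update v l (a l)) n (c (a n))) :=
      compat_update (compat_update (hc.compat_symm hvx) (by rwa [hxl])) (by rwa [hxn])
    obtain ⟨p, hp1, hp2, hp3⟩ := hc.exists_common hvx h1 h2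
    have h3 := hp3 n
    have h4 := hp3 l
    rw [Function.update_self] at h3
    rw [Function.update_of_ne hn.symm, Function.update_self] at h4
    rcases hcov p hp1 hp2 with h5 | h5
    · exact compl_notMem _ (h5 n) h3
    · have := h5 l
      rw [hab] at this
      exact compl_notMem _ h4 this
  refine ⟨l, hl, hxl, fun n hn => ⟨?_, ?_⟩⟩
  · exact key z w hvz hl hz (fun p hp hx => (h p hp).1 hx) n hn
  · exact key w z hvw (hc.eq_comm hl) hw (fun p hp hx => ((h p hp).1 hx).symm) n hn

end Points

section Sections

variable {c : S → S} {d : ℕ}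

open Classical in
/-- The words of `K` carrying the letter `s` at position `i`. -/
noncomputable def slice (K : Finset (Fin d → S)) (i : Fin d) (s : S) : Finset (Fin d → S) :=
  K.filter fun w => w i = s

open Classical in
/-- The words of `K` with letter `s` at position `i`, rewritten to agree with `u` at `i`, which are
not dichotomous to `u`. -/
noncomputable def sec (c : S → S) (K : Finset (Fin d → S)) (u : Fin d → S) (i : Fin d) (s : S) :
    Finset (Fin d → S) :=
  ((slice K i s).image fun w => Function.update w i (u i)).filter fun w => ¬ Dicho c u w

/-- Some word of `K` with letter `s` at position `i` contains `p` up to position `i`. -/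
def HitAt (K : Finset (Fin d → S)) (i : Fin d) (s : S) (p : Pt c d) : Prop :=
  ∃ w ∈ K, w i = s ∧ ∀ n, n ≠ i → w n ∈ (p n : Set S)

theorem mem_slice {K : Finset (Fin d → S)} {i : Fin d} {s : S} {w : Fin d → S} :
    w ∈ slice K i s ↔ w ∈ K ∧ w i = s := by
  simp [slice]

theorem mem_sec {K : Finset (Fin d → S)} {u : Fin d → S} {i : Fin d} {s : S} {w : Fin d → S} :
    w ∈ sec c K u i s ↔ w i = u i ∧ Function.update w i s ∈ K ∧ ¬ Dicho c u w := by
  simp only [sec, Finset.mem_filter, Finset.mem_image, mem_slice]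
  constructor
  · rintro ⟨⟨v, ⟨hv, rfl⟩, rfl⟩, h⟩
    simpa [hv] using h
  · rintro ⟨h1, h2, h3⟩
    exact ⟨⟨_, ⟨h2, by simp⟩, by simp [← h1]⟩, h3⟩

theorem update_mem_sec {K : Finset (Fin d → S)} {u : Fin d → S} {i : Fin d} {s : S}
    {w : Fin d → S} (hw : w ∈ K) (hs : w i = s) (h : ¬ Dicho c u (Function.update w i (u i))) :
    Function.update w i (u i) ∈ sec c K u i s := by
  subst hs
  exact mem_sec.2 ⟨by simp, by simpa using hw, h⟩

theorem sec_compat {K : Finset (Fin d → S)} {u : Fin d → S} {i : Fin d} {s : S} {w : Fin d → S}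
    (h : w ∈ sec c K u i s) : ¬ Dicho c u w := (mem_sec.1 h).2.2

theorem sec_card_le (c : S → S) (K : Finset (Fin d → S)) (u : Fin d → S) (i : Fin d) (s : S) :
    (sec c K u i s).card ≤ (slice K i s).card := by
  classical
  exact (Finset.card_filter_le _ _).trans Finset.card_image_le

theorem compat_of_slice_card_le {K : Finset (Fin d → S)} {u : Fin d → S} {i : Fin d} {s : S}
    (h : (slice K i s).card ≤ (sec c K u i s).card) {v : Fin d → S} (hv : v ∈ K) (hs : v i = s) :
    ¬ Dicho c u (Function.update v i (u i)) := by
  classical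
  have h1 : (slice K i s).card ≤ (((slice K i s).image fun w => Function.update w i (u i)).filter
    fun w => ¬ Dicho c u w).card := by
    unfold sec at h
    convert h
  have h2 : ((slice K i s).image fun w => Function.update w i (u i)).card ≤ _ :=
    Finset.card_image_le
  have h3 := Finset.eq_of_subset_of_card_le (Finset.filter_subset _ _) (h2.trans h1)
  have h4 : Function.update v i (u i) ∈ (slice K i s).image fun w => Function.update w i (u i) :=
    Finset.mem_image_of_mem _ (mem_slice.2 ⟨hv, hs⟩)
  rw [← h3] at h4
  exact (Finset.mem_filter.1 h4).2

theorem sum_slice_le (K : Finset (Fin d → S)) (i : Fin d) (l : List S) (hl : l.Nodup) :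
    (l.map fun s => (slice K i s).card).sum ≤ K.card := by
  classical
  rw [← List.sum_toFinset _ hl, ← Finset.card_biUnion]
  · refine Finset.card_le_card fun w hw => ?_
    obtain ⟨s, -, hs⟩ := Finset.mem_biUnion.1 hw
    exact (mem_slice.1 hs).1
  · intro s _ t _ hst
    refine Finset.disjoint_left.2 fun w h1 h2 => hst ?_
    rw [← (mem_slice.1 h1).2, (mem_slice.1 h2).2]

theorem hit_sec {K : Finset (Fin d → S)} {u : Fin d → S} {i : Fin d} {s : S} {p : Pt c d}
    (hp : InBox u p) : Hit (sec c K u i s) p ↔ HitAt K i s p := by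
  constructor
  · rintro ⟨w, hw, hwp⟩
    refine ⟨_, (mem_sec.1 hw).2.1, by simp, fun n hn => ?_⟩
    rw [Function.update_of_ne hn]
    exact hwp n
  · rintro ⟨w, hw, hs, hwp⟩
    have h : InBox (Function.update w i (u i)) p := inBox_update.2 ⟨hp i, hwp⟩
    exact ⟨_, update_mem_sec hw hs (not_dicho_of_inBox hp h), h⟩

theorem TwinFreeCode.mono {A B : Finset (Fin d → S)} (h : TwinFreeCode c B) (hAB : A ⊆ B) :
    TwinFreeCode c A :=
  ⟨fun u hu v hv => h.code u (hAB hu) v (hAB hv), fun u hu v hv => h.noTwin u (hAB hu) v (hAB hv)⟩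

theorem TwinFreeCode.twinFree_sec {K : Finset (Fin d → S)} (hc : IsComplementation c)
    (hK : TwinFreeCode c K) (u : Fin d → S) (i : Fin d) (s : S) :
    TwinFreeCode c (sec c K u i s) := by
  refine ⟨fun x hx y hy hxy => ?_, fun x hx y hy ⟨j, hj, h⟩ => ?_⟩
  · have hx := mem_sec.1 hx
    have hy := mem_sec.1 hy
    obtain ⟨j, hj⟩ := hK.code _ hx.2.1 _ hy.2.1 fun h => hxy <| by
      funext n
      by_cases hn : n = i
      · rw [hn, hx.1, hy.1]
      · simpa [hn] using congrFun h n
    refine ⟨j, ?_⟩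
    by_cases hji : j = i
    · rw [hji] at hj
      simp only [Function.update_self] at hj
      exact absurd hj.symm (hc.ne _)
    · simpa [hji] using hj
  · have hx := mem_sec.1 hx
    have hy := mem_sec.1 hy
    refine hK.noTwin _ hx.2.1 _ hy.2.1 ⟨j, ?_, fun n hn => ?_⟩
    · by_cases hji : j = i
      · rw [hji, hy.1, hx.1] at hj
        exact absurd hj.symm (hc.ne _)
      · simpa [hji] using hj
    · by_cases hni : n = i
      · simp [hni]
      · simpa [hni] using h n hn

theorem TwinFreeCode.sec_disjoint {K : Finset (Fin d → S)} (hK : TwinFreeCode c K)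
    {u w : Fin d → S} {i : Fin d} {s : S} (h1 : w ∈ sec c K u i s)
    (h2 : w ∈ sec c K u i (c s)) : False := by
  refine hK.noTwin _ (mem_sec.1 h1).2.1 _ (mem_sec.1 h2).2.1 ⟨i, by simp, fun n hn => ?_⟩
  simp [hn]

/-- Exchanging a letter used by `y ∈ K` at position `i` for its complement. -/
theorem hitAt_compl {K : Finset (Fin d → S)} (hK : PolyboxCode c (K : Set (Fin d → S)))
    {i : Fin d} {f : S} {p : Pt c d} {B B' : ESet c} (hy : HitAt K i f p) (hf : f ∈ (B : Set S))
    (hf' : c f ∈ (B' : Set S))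
    (hB : ∀ s, s ≠ f → s ≠ c f → (s ∈ (B' : Set S) ↔ s ∈ (B : Set S)))
    (h : Hit K (Function.update p i B')) : HitAt K i (c f) p := by
  obtain ⟨y, hyK, hyf, hyp⟩ := hy
  obtain ⟨w, hw, hwp⟩ := h
  rw [inBox_update_pt] at hwp
  refine ⟨w, hw, ?_, hwp.2⟩
  by_contra hne
  have hne' : w i ≠ f := fun h' => notMem_of_compl B' hf' (h' ▸ hwp.1)
  have h1 : InBox w (Function.update p i B) :=
    inBox_update_pt.2 ⟨(hB _ hne' hne).1 hwp.1, hwp.2⟩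
  have h2 : InBox y (Function.update p i B) := inBox_update_pt.2 ⟨hyf ▸ hf, hyp⟩
  exact hne' (by rw [code_unique hK hw hyK h1 h2, hyf])

theorem IsComplementation.hitAt_compl_of_cover_off [Finite S] (hc : IsComplementation c)
    {K : Finset (Fin d → S)} (hK : PolyboxCode c (K : Set (Fin d → S))) {i : Fin d} {p : Pt c d}
    (h : ∀ B, Hit K (Function.update p i B)) (f : S) :
    HitAt K i f p ↔ HitAt K i (c f) p := by
  have key : ∀ f, HitAt K i f p → HitAt K i (c f) p := by
    intro f hf
    obtain ⟨B, hB, -⟩ := hc.exists_three (hc.ne f).symm (hc.ne f).symm (hc.ne f).symm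
    obtain ⟨B', h1, h2⟩ := hc.exists_flip B f
    exact hitAt_compl hK hf hB h1 h2 (h B')
  refine ⟨key f, fun h' => ?_⟩
  simpa only [hc.invol] using key _ h'

theorem IsComplementation.hitAt_compl_of_cover [Finite S] (hc : IsComplementation c)
    {K : Finset (Fin d → S)} (hK : PolyboxCode c (K : Set (Fin d → S))) {u : Fin d → S} {i : Fin d}
    (h : ∀ p : Pt c d, InBox u p → Hit K p) {f : S} (h1 : f ≠ u i) (h2 : f ≠ c (u i))
    {p : Pt c d} (hp : InBox u p) : HitAt K i f p ↔ HitAt K i (c f) p := by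
  have key : ∀ f, f ≠ u i → f ≠ c (u i) → HitAt K i f p → HitAt K i (c f) p := by
    intro f h1 h2 hf
    obtain ⟨B, hB, hB', -⟩ := hc.exists_three h2 h2 (hc.ne f).symm
    obtain ⟨B', h3, h4⟩ := hc.exists_flip B f
    refine hitAt_compl hK hf hB' h3 h4 (h _ (inBox_update_pt.2 ⟨?_, fun n _ => hp n⟩))
    exact (h4 _ h1.symm (hc.ne_comm h2)).2 hB
  refine ⟨key f h1 h2, fun h' => ?_⟩
  simpa only [hc.invol] using
    key (c f) (fun h => h2 (hc.eq_comm h.symm)) (fun h => h1 (hc.inj h)) h'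

/-- Cover bound for codes with at most `n` words. -/
def CoverBound (c : S → S) (d n : ℕ) : Prop :=
  ∀ (A : Finset (Fin d → S)) (v : Fin d → S), A.card ≤ n → TwinFreeCode c A →
    (∀ p : Pt c d, InBox v p → Hit A p) → v ∈ A ∨ 5 ≤ A.card

theorem CoverBound.eq_singleton [Finite S] (hc : IsComplementation c) {n : ℕ}
    (hC : CoverBound c d n) {v x : Fin d → S} {A : Finset (Fin d → S)} (hn : A.card ≤ n)
    (hA : TwinFreeCode c A) (hvx : ¬ Dicho c v x) (hvA : ∀ a ∈ A, ¬ Dicho c v a)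
    (h : ∀ p : Pt c d, InBox v p → (InBox x p ↔ Hit A p)) : A = {x} ∨ 5 ≤ A.card := by
  have hx : ∀ a ∈ A, ∀ n, x n = v n ∨ x n = a n := fun a ha =>
    hc.letter_of_subset (hvA a ha) fun p hp hap => (h p hp).2 ⟨a, ha, hap⟩
  obtain h1 | h1 := hC A x hn hA fun p hp => by
    have hB : ∀ n, ∃ B : ESet c, v n ∈ (B : Set S) ∧ x n ∈ (B : Set S) ∧
        (x n = v n → B = p n) := fun n => by
      by_cases hxv : x n = v n
      · exact ⟨p n, hxv ▸ hp n, hp n, fun _ => rfl⟩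
      · obtain ⟨B, hB1, hB2, -⟩ := hc.exists_three (fun h' => hvx ⟨n, h'⟩)
          (fun h' => hvx ⟨n, h'⟩) (hc.ne _).symm
        exact ⟨B, hB1, hB2, fun h => absurd h hxv⟩
    choose q hq using hB
    obtain ⟨a, ha, haq⟩ := (h q fun n => (hq n).1).1 fun n => (hq n).2.1
    refine ⟨a, ha, fun n => ?_⟩
    by_cases hxv : x n = v n
    · rw [← (hq n).2.2 hxv]
      exact haq n
    · rw [← (hx a ha n).resolve_left hxv]
      exact hp n
  · left
    refine Finset.eq_singleton_iff_unique_mem.2 ⟨h1, fun a ha => ?_⟩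
    obtain ⟨p, hp, hap⟩ := hc.exists_common₂ (hvA a ha)
    exact code_unique hA.code ha h1 hap ((h p hp).2 ⟨a, ha, hap⟩)
  · exact Or.inr h1

theorem IsComplementation.coverBound [Finite S] (hc : IsComplementation c) (n : ℕ) :
    CoverBound c d n := by
  classical
  induction n with
  | zero =>
    intro A v hn _ h
    obtain ⟨p, hp, -⟩ := hc.exists_common₂ (hc.compat_self v)
    obtain ⟨a, ha, -⟩ := h p hp
    rw [Finset.card_eq_zero.1 (Nat.le_zero.1 hn)] at ha
    simp at ha
  | succ n ih =>
    intro A v hn hA h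
    by_cases hcomp : ∃ a ∈ A, Dicho c v a
    · obtain ⟨a, ha, hva⟩ := hcomp
      have h1 := Finset.card_erase_add_one ha
      obtain h2 | h2 := ih (A.erase a) v (by omega) (hA.mono (A.erase_subset a)) fun p hp => by
        obtain ⟨b, hb, hbp⟩ := h p hp
        refine ⟨b, Finset.mem_erase.2 ⟨?_, hb⟩, hbp⟩
        rintro rfl
        exact not_dicho_of_inBox hp hbp hva
      · exact Or.inl (Finset.mem_of_mem_erase h2)
      · right
        omega
    push Not at hcomp
    by_contra! hcon
    obtain ⟨hvA, hA5⟩ := hcon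
    obtain ⟨p, hp, -⟩ := hc.exists_common₂ (hc.compat_self v)
    obtain ⟨y, hyA, hyp⟩ := h p hp
    obtain ⟨i, hi⟩ : ∃ i, y i ≠ v i := by
      by_contra! h'
      exact hvA (funext h' ▸ hyA)
    have hi' : y i ≠ c (v i) := fun h' => hcomp y hyA ⟨i, h'⟩
    have hflip := fun (p : Pt c d) (hp : InBox v p) =>
      (hit_sec hp).trans ((hc.hitAt_compl_of_cover hA.code h hi hi' hp).trans (hit_sec hp).symm)
    have h0 : y i ∉ [c (y i)] := by simpa using (hc.ne _).symm
    have hsum := sum_slice_le A i [y i, c (y i)] (by simpa using h0)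
    have hsum3 := fun a (h1 : a ≠ y i) (h2 : a ≠ c (y i)) =>
      sum_slice_le A i [a, y i, c (y i)] (by simpa [h1, h2] using h0)
    have hle := sec_card_le c A v i (y i)
    have hle' := sec_card_le c A v i (c (y i))
    simp only [List.map_cons, List.map_nil, List.sum_cons, List.sum_nil] at hsum hsum3
    have hP := hA.twinFree_sec hc v i (y i)
    have hP' := hA.twinFree_sec hc v i (c (y i))
    have hPv : ∀ a ∈ sec c A v i (y i), ¬ Dicho c v a := fun a ha => sec_compat ha
    have hPv' : ∀ a ∈ sec c A v i (c (y i)), ¬ Dicho c v a := fun a ha => sec_compat ha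
    have hdisj : ∀ w, w ∈ sec c A v i (y i) → w ∈ sec c A v i (c (y i)) → False :=
      fun w => hA.sec_disjoint
    have hne : 0 < (sec c A v i (y i)).card := Finset.card_pos.2
      ⟨_, update_mem_sec hyA rfl (compat_update (hcomp y hyA) (hc.ne _).symm)⟩
    have hne' : 0 < (sec c A v i (c (y i))).card := by
      obtain ⟨x, hx⟩ := Finset.card_pos.1 hne
      obtain ⟨p, hp, hxp⟩ := hc.exists_common₂ (hPv x hx)
      obtain ⟨z, hz, -⟩ := (hflip p hp).1 ⟨x, hx, hxp⟩
      exact Finset.card_pos.2 ⟨z, hz⟩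
    have h1 : (sec c A v i (y i)).card ≠ 1 := fun h1 => by
      obtain ⟨x, hx⟩ := Finset.card_eq_one.1 h1
      obtain h2 | h2 := ih.eq_singleton hc (x := x) (by omega) hP' (hPv x (by simp [hx])) hPv'
        (fun p hp => by rw [← hflip p hp, hx]; simp [Hit])
      · exact hdisj x (by simp [hx]) (by simp [h2])
      · omega
    have h1' : (sec c A v i (c (y i))).card ≠ 1 := fun h1 => by
      obtain ⟨x, hx⟩ := Finset.card_eq_one.1 h1
      obtain h2 | h2 := ih.eq_singleton hc (x := x) (by omega) hP (hPv' x (by simp [hx])) hPv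
        (fun p hp => by rw [hflip p hp, hx]; simp [Hit])
      · exact hdisj x (by simp [h2]) (by simp [hx])
      · omega
    have hcov : ∀ p : Pt c d, InBox v p → HitAt A i (y i) p := fun p hp => by
      obtain ⟨B, hB1, hB2, -⟩ := hc.exists_three hi' hi' (hc.ne _).symm
      obtain ⟨a, ha, hap⟩ := h (Function.update p i B) (inBox_update_pt.2 ⟨hB1, fun n _ => hp n⟩)
      rw [inBox_update_pt] at hap
      refine ⟨a, ha, ?_, hap.2⟩
      by_contra h2
      have h3 : a i ≠ c (y i) := fun h' => compl_notMem B hB2 (h' ▸ hap.1)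
      have h4 := hsum3 _ h2 h3
      have h5 : 0 < (slice A i (a i)).card := Finset.card_pos.2 ⟨a, mem_slice.2 ⟨ha, rfl⟩⟩
      omega
    obtain h2 | h2 := ih _ v (by omega) hP fun p hp => (hit_sec hp).2 (hcov p hp)
    · obtain h3 | h3 := ih _ v (by omega) hP' fun p hp =>
        (hflip p hp).1 ((hit_sec hp).2 (hcov p hp))
      · exact hdisj v h2 h3
      · omega
    · omega

/-- A word covered by a twin-free code not containing it needs at least five words. -/
theorem IsComplementation.cover_five [Finite S] (hc : IsComplementation c) {A : Finset (Fin d → S)}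
    {v : Fin d → S} (hA : TwinFreeCode c A) (h : ∀ p : Pt c d, InBox v p → Hit A p) :
    v ∈ A ∨ 5 ≤ A.card := hc.coverBound _ A v le_rfl hA h

theorem IsComplementation.trace_singleton [Finite S] (hc : IsComplementation c) {v x : Fin d → S}
    {A : Finset (Fin d → S)} (hA : TwinFreeCode c A) (hvx : ¬ Dicho c v x)
    (hvA : ∀ a ∈ A, ¬ Dicho c v a)
    (h : ∀ p : Pt c d, InBox v p → (InBox x p ↔ Hit A p)) : A = {x} ∨ 5 ≤ A.card :=
  (hc.coverBound _).eq_singleton hc le_rfl hA hvx hvA h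

/-- Sizes of disjoint twin-free codes with the same trace on `v`. -/
theorem IsComplementation.trace_card [Finite S] (hc : IsComplementation c) {v : Fin d → S}
    {A A' : Finset (Fin d → S)} (hA : TwinFreeCode c A) (hA' : TwinFreeCode c A')
    (hvA : ∀ a ∈ A, ¬ Dicho c v a) (hvA' : ∀ a ∈ A', ¬ Dicho c v a)
    (hdisj : ∀ a, a ∈ A → a ∈ A' → False)
    (h : ∀ p : Pt c d, InBox v p → (Hit A p ↔ Hit A' p)) :
    (A.card = 0 ∧ A'.card = 0) ∨ (2 ≤ A.card ∧ 2 ≤ A'.card) ∨ (A.card = 1 ∧ 5 ≤ A'.card) ∨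
      (A'.card = 1 ∧ 5 ≤ A.card) := by
  have key : ∀ {A A' : Finset (Fin d → S)}, TwinFreeCode c A' →
      (∀ a ∈ A, ¬ Dicho c v a) → (∀ a ∈ A', ¬ Dicho c v a) → (∀ a, a ∈ A → a ∈ A' → False) →
      (∀ p : Pt c d, InBox v p → (Hit A p ↔ Hit A' p)) →
      (A.card = 1 → 5 ≤ A'.card) ∧ (A.card = 0 → A'.card = 0) := by
    intro A A' hA' hvA hvA' hdisj h
    refine ⟨fun h1 => ?_, fun h0 => ?_⟩
    · obtain ⟨x, rfl⟩ := Finset.card_eq_one.1 h1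
      refine (hc.trace_singleton hA' (hvA x (by simp)) hvA' fun p hp => ?_).resolve_left
        fun h2 => ?_
      · rw [← h p hp]
        simp [Hit]
      · exact hdisj x (by simp) (by simp [h2])
    · refine Finset.card_eq_zero.2 (Finset.eq_empty_of_forall_notMem fun a ha => ?_)
      obtain ⟨p, hp, hap⟩ := hc.exists_common₂ (hvA' a ha)
      obtain ⟨b, hb, -⟩ := (h p hp).2 ⟨a, ha, hap⟩
      rw [Finset.card_eq_zero.1 h0] at hb
      simp at hb
  have k1 := key hA' hvA hvA' hdisj h
  have k2 := key hA hvA' hvA (fun a h1 h2 => hdisj a h2 h1) fun p hp => (h p hp).symm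
  omega

/-- Sizes of the two sections at complementary letters with the same trace on `v`. -/
theorem TwinFreeCode.sec_trace_card [Finite S] (hc : IsComplementation c)
    {K : Finset (Fin d → S)} (hK : TwinFreeCode c K) {v : Fin d → S} {i : Fin d} {s : S}
    (h : ∀ p : Pt c d, InBox v p → (HitAt K i s p ↔ HitAt K i (c s) p)) :
    ((sec c K v i s).card = 0 ∧ (sec c K v i (c s)).card = 0) ∨
    (2 ≤ (sec c K v i s).card ∧ 2 ≤ (sec c K v i (c s)).card) ∨
    ((sec c K v i s).card = 1 ∧ 5 ≤ (sec c K v i (c s)).card) ∨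
    ((sec c K v i (c s)).card = 1 ∧ 5 ≤ (sec c K v i s).card) :=
  hc.trace_card (hK.twinFree_sec hc v i s) (hK.twinFree_sec hc v i (c s)) (fun _ h => sec_compat h)
    (fun _ h => sec_compat h) (fun _ h1 h2 => hK.sec_disjoint h1 h2)
    fun p hp => (hit_sec hp).trans ((h p hp).trans (hit_sec hp).symm)

end Sections

section SplitPairs

variable {c : S → S} {d : ℕ}

/-- The shape of two disjoint twin-free codes `A`, `A'` of two words with the same trace on `v`. -/
structure SplitPair (c : S → S) (v x : Fin d → S) (k l : Fin d) (A A' : Finset (Fin d → S)) :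
    Prop where
  ne : k ≠ l
  ne_k : x k ≠ v k
  ne_l : x l ≠ v l
  mem : ∀ w, w ∈ A ↔ w = x ∨ w = Function.update (Function.update x k (c (x k))) l (v l)
  mem' : ∀ w, w ∈ A' ↔ w = Function.update x k (v k) ∨
    w = Function.update (Function.update x k (c (x k))) l (c (x l))

theorem IsComplementation.slice_trace [Finite S] (hc : IsComplementation c) {v x y : Fin d → S}
    {k : Fin d} {A A' : Finset (Fin d → S)} (hA : ∀ w, w ∈ A ↔ w = x ∨ w = y)
    (hk : y k = c (x k)) (hx : ¬ Dicho c v x)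
    (hA' : ∀ w ∈ A', w k = v k ∨ w k = x k ∨ w k = c (x k))
    (h : ∀ p : Pt c d, InBox v p → (Hit A p ↔ Hit A' p)) {p : Pt c d} (hp : InBox v p) :
    InBox (Function.update x k (v k)) p ↔
      ∃ w ∈ A', (w k = v k ∨ w k = x k) ∧ InBox (Function.update w k (v k)) p := by
  have hxv : x k ≠ c (v k) := fun h => hx ⟨k, h⟩
  obtain ⟨B, hB, hB', -⟩ := hc.exists_three hxv hxv (hc.ne (x k)).symm
  have hB1 : InBox v (Function.update p k B) := inBox_update_pt.2 ⟨hB, fun n _ => hp n⟩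
  have h' := h _ hB1
  constructor
  · intro hxp
    rw [inBox_update] at hxp
    obtain ⟨w, hw, hwp⟩ := h'.1 ⟨x, (hA x).2 (Or.inl rfl), inBox_update_pt.2 ⟨hB', hxp.2⟩⟩
    rw [inBox_update_pt] at hwp
    refine ⟨w, hw, ?_, inBox_update.2 ⟨hp k, hwp.2⟩⟩
    rcases hA' w hw with h1 | h1 | h1
    · exact Or.inl h1
    · exact Or.inr h1
    · exact absurd (h1 ▸ hwp.1) (compl_notMem B hB')
  · rintro ⟨w, hw, hwk, hwp⟩
    rw [inBox_update] at hwp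
    obtain ⟨u, hu, hup⟩ := h'.2 ⟨w, hw, inBox_update_pt.2
      ⟨by rcases hwk with h1 | h1 <;> rw [h1] <;> assumption, hwp.2⟩⟩
    rw [inBox_update_pt] at hup
    rcases (hA u).1 hu with rfl | rfl
    · exact inBox_update.2 ⟨hp k, hup.2⟩
    · exact absurd (hk ▸ hup.1) (compl_notMem B hB')

theorem IsComplementation.splitPair_of_letters [Finite S] (hc : IsComplementation c)
    {v x y a b : Fin d → S} {k : Fin d} {A A' : Finset (Fin d → S)}
    (hA : ∀ w, w ∈ A ↔ w = x ∨ w = y) (hA' : ∀ w, w ∈ A' ↔ w = a ∨ w = b)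
    (hab : Dicho c a b) (hk : y k = c (x k)) (hx : ¬ Dicho c v x) (hy : ¬ Dicho c v y)
    (ha : ¬ Dicho c v a) (hb : ¬ Dicho c v b) (hak : a k = v k) (hbk : b k = c (x k))
    (h : ∀ p : Pt c d, InBox v p → (Hit A p ↔ Hit A' p)) :
    ∃ l, SplitPair c v x k l A A' := by
  have hxv : x k ≠ v k := fun h1 => hy ⟨k, by rw [hk, h1]⟩
  have hxv' : c (x k) ≠ v k := fun h1 => hx ⟨k, by rw [← h1, hc.invol]⟩
  have hx' : ¬ Dicho c v (Function.update x k (v k)) := compat_update hx (hc.ne _).symm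
  have hy' : ¬ Dicho c v (Function.update y k (v k)) := compat_update hy (hc.ne _).symm
  have hb' : ¬ Dicho c v (Function.update b k (v k)) := compat_update hb (hc.ne _).symm
  have haa : Function.update a k (v k) = a := by rw [← hak, Function.update_eq_self]
  have hX : ∀ p : Pt c d, InBox v p → (InBox (Function.update x k (v k)) p ↔ InBox a p) := by
    intro p hp
    rw [hc.slice_trace hA hk hx (fun w hw => ?_) h hp]
    · constructor
      · rintro ⟨w, hw, h1, h2⟩
        rcases (hA' w).1 hw with rfl | rfl
        · rwa [haa] at h2
        · rw [hbk] at h1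
          rcases h1 with h1 | h1
          exacts [absurd h1 hxv', absurd h1 (hc.ne _)]
      · intro h1
        exact ⟨a, (hA' a).2 (Or.inl rfl), Or.inl hak, by rwa [haa]⟩
    · rcases (hA' w).1 hw with rfl | rfl
      exacts [Or.inl hak, Or.inr (Or.inr hbk)]
  have hY : ∀ p : Pt c d, InBox v p → (InBox (Function.update y k (v k)) p ↔
      InBox a p ∨ InBox (Function.update b k (v k)) p) := by
    intro p hp
    rw [hc.slice_trace (x := y) (y := x) (fun w => (hA w).trans or_comm) (hc.eq_comm hk) hy
      (fun w hw => ?_) h hp]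
    · constructor
      · rintro ⟨w, hw, h1, h2⟩
        rcases (hA' w).1 hw with rfl | rfl
        · rw [haa] at h2
          exact Or.inl h2
        · exact Or.inr h2
      · rintro (h1 | h1)
        · exact ⟨a, (hA' a).2 (Or.inl rfl), Or.inl hak, by rwa [haa]⟩
        · exact ⟨b, (hA' b).2 (Or.inr rfl), Or.inr (by rw [hbk, hk]), h1⟩
    · rcases (hA' w).1 hw with rfl | rfl
      exacts [Or.inl hak, Or.inr (Or.inl (by rw [hbk, hk]))]
  have hxa := hc.eq_of_trace_eq hx' ha hX
  obtain ⟨j, hj⟩ := hab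
  have hjk : j ≠ k := by
    rintro rfl
    rw [hbk, hak] at hj
    exact hxv (hc.inj hj)
  obtain ⟨l, h1, h2, h3⟩ := hc.halves hy' ha hb'
    ⟨j, by rwa [Function.update_of_ne hjk]⟩ hY
  have hlk : l ≠ k := by
    rintro rfl
    rw [Function.update_self, hak] at h1
    exact hc.ne _ h1.symm
  rw [Function.update_of_ne hlk] at h1 h2
  have hal : a l = x l := by rw [← hxa, Function.update_of_ne hlk]
  have hyeq : y = Function.update (Function.update x k (c (x k))) l (v l) := by
    funext n
    by_cases hn : n = l
    · rw [hn, h2, Function.update_self]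
    · by_cases hn' : n = k
      · rw [hn', hk, Function.update_of_ne hlk.symm, Function.update_self]
      · have h4 := (h3 n hn).1
        rw [← hxa, Function.update_of_ne hn', Function.update_of_ne hn'] at h4
        rw [Function.update_of_ne hn, Function.update_of_ne hn', h4]
  have hbeq : b = Function.update (Function.update x k (c (x k))) l (c (x l)) := by
    funext n
    by_cases hn : n = l
    · rw [hn, h1, Function.update_self, hal]
    · by_cases hn' : n = k
      · rw [hn', hbk, Function.update_of_ne hlk.symm, Function.update_self]
      · have h4 := (h3 n hn).1
        have h5 := (h3 n hn).2
        rw [← h4, ← hxa, Function.update_of_ne hn', Function.update_of_ne hn'] at h5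
        rw [Function.update_of_ne hn, Function.update_of_ne hn', h5]
  refine ⟨l, hlk.symm, hxv, fun h4 => hb ⟨l, by rw [h1, hal, h4]⟩, fun w => ?_, fun w => ?_⟩
  · rw [hA, ← hyeq]
  · rw [hA', hxa, ← hbeq]

theorem IsComplementation.exists_splitPair [Finite S] (hc : IsComplementation c) {v : Fin d → S}
    {A A' : Finset (Fin d → S)} (hA : TwinFreeCode c A) (hA' : TwinFreeCode c A')
    (h2 : A.card = 2) (h2' : A'.card = 2) (hvA : ∀ a ∈ A, ¬ Dicho c v a)
    (hvA' : ∀ a ∈ A', ¬ Dicho c v a) (hdisj : ∀ a, a ∈ A → a ∈ A' → False)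
    (h : ∀ p : Pt c d, InBox v p → (Hit A p ↔ Hit A' p)) :
    ∃ x k l, SplitPair c v x k l A A' := by
  classical
  obtain ⟨x, y, hxy, rfl⟩ := Finset.card_eq_two.1 h2
  obtain ⟨a, b, hab, rfl⟩ := Finset.card_eq_two.1 h2'
  obtain ⟨k, hk⟩ := hA.code x (by simp) y (by simp) hxy
  have hxv : x k ≠ c (v k) := fun h => hvA x (by simp) ⟨k, h⟩
  have hyv : y k ≠ c (v k) := fun h => hvA y (by simp) ⟨k, h⟩
  have hletter : ∀ w ∈ ({a, b} : Finset (Fin d → S)), w k = v k ∨ w k = x k ∨ w k = y k := by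
    intro w hw
    by_contra! hcon
    obtain ⟨h0, h1, h2⟩ := hcon
    have key : ∀ f, f ≠ v k → f ≠ c (v k) → f ≠ x k → f ≠ y k → ∀ p : Pt c d, InBox v p →
        HitAt {a, b} k f p → HitAt {a, b} k (c f) p := by
      intro f h0 h0' h1 h2 p hp hf
      have h1' : f ≠ c (x k) := hk ▸ h2
      have h2' : f ≠ c (y k) := by rw [hk, hc.invol]; exact h1
      obtain ⟨B, hB, hB', -⟩ := hc.exists_three h0' h0' (hc.ne f).symm
      obtain ⟨B', h3, h4⟩ := hc.exists_flip B f
      refine hitAt_compl hA'.code hf hB' h3 h4 ?_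
      have hB1 : InBox v (Function.update p k B) := inBox_update_pt.2 ⟨hB, fun n _ => hp n⟩
      have hB2 : InBox v (Function.update p k B') :=
        inBox_update_pt.2 ⟨(h4 _ h0.symm (hc.ne_comm h0')).2 hB, fun n _ => hp n⟩
      rw [← h _ hB2]
      obtain ⟨w, hw, hwf, hwp⟩ := hf
      obtain ⟨u, hu, hup⟩ := (h _ hB1).2 ⟨w, hw, inBox_update_pt.2 ⟨hwf ▸ hB', hwp⟩⟩
      refine ⟨u, hu, ?_⟩
      rw [inBox_update_pt] at hup ⊢
      refine ⟨(h4 _ ?_ ?_).2 hup.1, hup.2⟩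
      · simp only [Finset.mem_insert, Finset.mem_singleton] at hu
        rcases hu with rfl | rfl
        exacts [h1.symm, h2.symm]
      · simp only [Finset.mem_insert, Finset.mem_singleton] at hu
        rcases hu with rfl | rfl
        exacts [hc.ne_comm h1', hc.ne_comm h2']
    have h0' : w k ≠ c (v k) := fun h => hvA' w hw ⟨k, h⟩
    have h3 := hA'.sec_trace_card hc (v := v) (i := k) (s := w k) fun p hp =>
      ⟨key _ h0 h0' h1 h2 p hp, fun h => by
        rw [← hc.invol (w k)]
        refine key _ (fun h => h0' (hc.eq_comm h.symm)) (fun h => h0 (hc.inj h)) (fun h => h2 ?_)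
          (fun h => h1 ?_) p hp h
        · rw [hk, ← h, hc.invol]
        · rw [hk] at h
          exact hc.inj h⟩
    have h4 := sum_slice_le {a, b} k [w k, c (w k)] (by simpa using (hc.ne _).symm)
    have h5 := sec_card_le c {a, b} v k (w k)
    have h6 := sec_card_le c {a, b} v k (c (w k))
    have h7 : 0 < (sec c {a, b} v k (w k)).card := Finset.card_pos.2
      ⟨_, update_mem_sec hw rfl (compat_update (hvA' w hw) (hc.ne _).symm)⟩
    simp only [List.map_cons, List.map_nil, List.sum_cons, List.sum_nil] at h4
    omega
  have hx := hvA x (by simp)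
  have hy := hvA y (by simp)
  have ha := hvA' a (by simp)
  have hb := hvA' b (by simp)
  have hmA : ∀ w, w ∈ ({x, y} : Finset (Fin d → S)) ↔ w = x ∨ w = y := fun w => by simp
  have hmA' : ∀ w, w ∈ ({a, b} : Finset (Fin d → S)) ↔ w = a ∨ w = b := fun w => by simp
  have hk' := hc.eq_comm hk
  have hmA2 := fun w => (hmA w).trans or_comm
  have hmA2' := fun w => (hmA' w).trans or_comm
  have hdab := hA'.code a (by simp) b (by simp) hab
  have hdba := hc.dicho_symm hdab
  have hxu : ¬ Dicho c v (Function.update x k (v k)) := compat_update hx (hc.ne _).symm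
  have hyu : ¬ Dicho c v (Function.update y k (v k)) := compat_update hy (hc.ne _).symm
  have hau : ¬ Dicho c v (Function.update a k (v k)) := compat_update ha (hc.ne _).symm
  have hbu : ¬ Dicho c v (Function.update b k (v k)) := compat_update hb (hc.ne _).symm
  have hX := fun (p : Pt c d) (hp : InBox v p) => hc.slice_trace hmA hk hx
    (fun w hw => by rw [← hk]; exact hletter w hw) h hp
  have hY := fun (p : Pt c d) (hp : InBox v p) => hc.slice_trace hmA2 hk' hy
    (fun w hw => by rw [← hk']; exact (hletter w hw).imp_right Or.symm) h hp
  have hxk : x k ≠ v k := fun h1 => hyv (by rw [hk, h1])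
  have hyk : y k ≠ v k := fun h1 => hxv (by rw [hk', h1])
  have hxyk : x k ≠ y k := fun h1 => hc.ne (x k) (by rw [← hk, h1])
  have hX0 : ¬ (a k = y k ∧ b k = y k) := by
    rintro ⟨h1, h2⟩
    obtain ⟨p, hp, hxp⟩ := hc.exists_common₂ hxu
    obtain ⟨w, hw, h3, -⟩ := (hX p hp).1 hxp
    rcases (hmA' w).1 hw with rfl | rfl <;> grind
  have hY0 : ¬ (a k = x k ∧ b k = x k) := by
    rintro ⟨h1, h2⟩
    obtain ⟨p, hp, hxp⟩ := hc.exists_common₂ hyu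
    obtain ⟨w, hw, h3, -⟩ := (hY p hp).1 hxp
    rcases (hmA' w).1 hw with rfl | rfl <;> grind
  have hvv : ¬ (a k = v k ∧ b k = v k) := by
    rintro ⟨h1, h2⟩
    have h3 := hc.eq_of_trace_eq hxu hyu fun p hp => by
      rw [hX p hp, hY p hp]
      simp [h1, h2]
    refine hA.noTwin x (by simp) y (by simp) ⟨k, hk, fun n hn => ?_⟩
    simpa [hn] using (congrFun h3 n).symm
  have hxz : ∀ w z, (∀ u, u ∈ ({a, b} : Finset (Fin d → S)) ↔ u = w ∨ u = z) → w k = x k →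
      z k = y k → False := by
    intro w z hwz h1 h2
    have hw := hvA' w ((hwz w).2 (Or.inl rfl))
    have h3 := hc.eq_of_trace_eq hxu (compat_update (n := k) hw (hc.ne _).symm) fun p hp => by
      rw [hX p hp]
      constructor
      · rintro ⟨u, hu, h4, h5⟩
        rcases (hwz u).1 hu with rfl | rfl
        · exact h5
        · rcases h4 with h4 | h4
          · exact absurd (h2.symm.trans h4) hyk
          · exact absurd (h2.symm.trans h4) hxyk.symm
      · exact fun h4 => ⟨w, (hwz w).2 (Or.inl rfl), Or.inr h1, h4⟩
    refine hdisj x (by simp) ((hwz x).2 (Or.inl (funext fun n => ?_)))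
    by_cases hn : n = k
    · rw [hn, h1]
    · simpa [hn] using congrFun h3 n
  rcases hletter a (by simp) with h1 | h1 | h1 <;> rcases hletter b (by simp) with h2 | h2 | h2
  · exact absurd ⟨h1, h2⟩ hvv
  · obtain ⟨l, hl⟩ := hc.splitPair_of_letters hmA2 hmA' hdab hk' hy hx ha hb h1 (h2.trans hk') h
    exact ⟨_, _, _, hl⟩
  · obtain ⟨l, hl⟩ := hc.splitPair_of_letters hmA hmA' hdab hk hx hy ha hb h1 (h2.trans hk) h
    exact ⟨_, _, _, hl⟩
  · obtain ⟨l, hl⟩ := hc.splitPair_of_letters hmA2 hmA2' hdba hk' hy hx hb ha h2 (h1.trans hk') h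
    exact ⟨_, _, _, hl⟩
  · exact absurd ⟨h1, h2⟩ hY0
  · exact (hxz a b hmA' h1 h2).elim
  · obtain ⟨l, hl⟩ := hc.splitPair_of_letters hmA hmA2' hdba hk hx hy hb ha h2 (h1.trans hk) h
    exact ⟨_, _, _, hl⟩
  · exact (hxz b a hmA2' h2 h1).elim
  · exact absurd ⟨h1, h2⟩ hX0

/-- If `x` differs from `v` only at `k` and `l`, the rest of `v` contains a box. -/
theorem SplitPair.mem_of_trivial [Finite S] (hc : IsComplementation c) {v x : Fin d → S}
    {k l : Fin d} {A A' Q : Finset (Fin d → S)} (hs : SplitPair c v x k l A A')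
    (hvA : ∀ a ∈ A, ¬ Dicho c v a)
    (hx : ∀ n, n ≠ k → n ≠ l → x n = v n) (hQ : TwinFreeCode c Q) (h5 : Q.card < 5)
    (hvQ : ∀ a ∈ Q, ¬ Dicho c v a)
    (h : ∀ p : Pt c d, InBox v p → (Hit Q p ↔ ¬ Hit A p)) :
    Function.update (Function.update v k (x k)) l (c (x l)) ∈ Q := by
  have hvx := hvA x ((hs.mem x).2 (Or.inl rfl))
  have h1 : ¬ Dicho c v (Function.update (Function.update v k (x k)) l (c (x l))) :=
    compat_update (compat_update (hc.compat_self v) fun h => hvx ⟨k, h⟩)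
      fun h => hs.ne_l (hc.inj h)
  have h2 := (hc.trace_singleton hQ h1 hvQ fun p hp => ?_).resolve_right (by omega)
  · rw [h2]
    simp
  rw [h p hp]
  have h3 : ∀ w : Fin d → S, (∀ n, n ≠ k → n ≠ l → w n = v n) →
      (InBox w p ↔ w k ∈ (p k : Set S) ∧ w l ∈ (p l : Set S)) := by
    intro w hw
    refine ⟨fun h => ⟨h k, h l⟩, fun h n => ?_⟩
    by_cases hk : n = k
    · rw [hk]; exact h.1
    · by_cases hl : n = l
      · rw [hl]; exact h.2
      · rw [hw n hk hl]
        exact hp n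
  have h4 : Hit A p ↔ (x k ∈ (p k : Set S) ∧ x l ∈ (p l : Set S)) ∨ c (x k) ∈ (p k : Set S) := by
    have hy := h3 (Function.update (Function.update x k (c (x k))) l (v l))
      fun n hk hl => by simp [hk, hl, hx n hk hl]
    have hvl := hp l
    simp only [Function.update_self, Function.update_of_ne hs.ne, hvl, and_true] at hy
    rw [← h3 x hx, ← hy]
    constructor
    · rintro ⟨w, hw, hwp⟩
      rcases (hs.mem w).1 hw with rfl | rfl
      exacts [Or.inl hwp, Or.inr hwp]
    · rintro (hwp | hwp)
      exacts [⟨_, (hs.mem _).2 (Or.inl rfl), hwp⟩, ⟨_, (hs.mem _).2 (Or.inr rfl), hwp⟩]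
  rw [h3 _ fun n hk hl => by simp [hk, hl], h4]
  simp only [Function.update_self, Function.update_of_ne hs.ne]
  have h6 := compl_notMem (p k) (a := x k)
  have h7 := compl_mem (p k) (a := x k)
  have h8 := compl_notMem (p l) (a := x l)
  have h9 := compl_mem (p l) (a := x l)
  tauto

/-- If `x` differs from `v` also at `m`, a small code completing `A` in `v` contains the
complementary half of `v` at `m`. -/
theorem SplitPair.mem_of_nontrivial [Finite S] (hc : IsComplementation c) {v x : Fin d → S}
    {k l m : Fin d} {A A' Q : Finset (Fin d → S)} (hs : SplitPair c v x k l A A')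
    (hA : TwinFreeCode c A) (hA2 : A.card = 2) (hvA : ∀ a ∈ A, ¬ Dicho c v a)
    (hmk : m ≠ k) (hml : m ≠ l) (hxm : x m ≠ v m)
    (hQ : TwinFreeCode c Q) (hQ2 : Q.card ≤ 2)
    (hvQ : ∀ a ∈ Q, ¬ Dicho c v a) (hAQ : ∀ a ∈ A, ∀ b ∈ Q, Dicho c a b)
    (h : ∀ p : Pt c d, InBox v p → Hit A p ∨ Hit Q p) :
    Function.update v m (c (x m)) ∈ Q := by
  classical
  have hvx := hvA x ((hs.mem x).2 (Or.inl rfl))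
  have hxm' : x m ≠ c (v m) := fun h => hvx ⟨m, h⟩
  have hAm : ∀ a ∈ A, a m = x m := by
    intro a ha
    rcases (hs.mem a).1 ha with rfl | rfl
    · rfl
    · simp [hmk, hml]
  have hK : PolyboxCode c ((A ∪ Q : Finset (Fin d → S)) : Set (Fin d → S)) := by
    intro a ha b hb hab
    rw [Finset.mem_coe, Finset.mem_union] at ha hb
    rcases ha with ha | ha <;> rcases hb with hb | hb
    · exact hA.code a ha b hb hab
    · exact hAQ a ha b hb
    · exact hc.dicho_symm (hAQ b hb a ha)
    · exact hQ.code a ha b hb hab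
  have hKc : ∀ p : Pt c d, InBox v p → Hit (A ∪ Q) p := by
    intro p hp
    rcases h p hp with ⟨a, ha, hap⟩ | ⟨a, ha, hap⟩
    exacts [⟨a, Finset.mem_union_left _ ha, hap⟩, ⟨a, Finset.mem_union_right _ ha, hap⟩]
  have hfl := fun f (h1 : f ≠ v m) (h2 : f ≠ c (v m)) (p : Pt c d) (hp : InBox v p) =>
    hc.hitAt_compl_of_cover hK hKc h1 h2 hp
  have hKQ : ∀ f, f ≠ x m → ∀ p : Pt c d, HitAt (A ∪ Q) m f p ↔ HitAt Q m f p := by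
    intro f hf p
    constructor
    · rintro ⟨w, hw, h1, h2⟩
      rcases Finset.mem_union.1 hw with hw | hw
      · exact absurd (h1.symm.trans (hAm w hw)) hf
      · exact ⟨w, hw, h1, h2⟩
    · rintro ⟨w, hw, h1, h2⟩
      exact ⟨w, Finset.mem_union_right _ hw, h1, h2⟩
  have hQm : ∀ o ∈ Q, o m = v m ∨ o m = x m ∨ o m = c (x m) := by
    intro o ho
    by_contra! hcon
    obtain ⟨h1, h2, h3⟩ := hcon
    have h1' : o m ≠ c (v m) := fun h => hvQ o ho ⟨m, h⟩
    have h4 : c (o m) ≠ x m := fun h => h3 (by rw [← h, hc.invol])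
    have h5 := hQ.sec_trace_card hc (v := v) (i := m) (s := o m) fun p hp => by
      rw [← hKQ _ h2, ← hKQ _ h4]
      exact hfl _ h1 h1' p hp
    have h6 := sum_slice_le Q m [o m, c (o m)] (by simpa using (hc.ne _).symm)
    have h7 := sec_card_le c Q v m (o m)
    have h8 := sec_card_le c Q v m (c (o m))
    have h9 : 0 < (sec c Q v m (o m)).card := Finset.card_pos.2
      ⟨_, update_mem_sec ho rfl (compat_update (hvQ o ho) (hc.ne _).symm)⟩
    simp only [List.map_cons, List.map_nil, List.sum_cons, List.sum_nil] at h6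
    omega
  by_cases hstar : ∃ o ∈ Q, o m = v m
  · exfalso
    obtain ⟨o', ho', ho'm⟩ := hstar
    have hxu : ¬ Dicho c v (Function.update x m (v m)) := compat_update hvx (hc.ne _).symm
    obtain ⟨p, hp, hxp⟩ := hc.exists_common₂ hxu
    rw [inBox_update] at hxp
    obtain ⟨o, ho, hom, -⟩ := (hKQ _ (hc.ne _) _).1 ((hfl _ hxm hxm' p hp).1
      ⟨x, Finset.mem_union_left _ ((hs.mem x).2 (Or.inl rfl)), rfl, hxp.2⟩)
    have hoo : o ≠ o' := by
      rintro rfl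
      exact hxm' (by rw [← ho'm, hom, hc.invol])
    have hQeq : ∀ w ∈ Q, w = o ∨ w = o' := by
      intro w hw
      by_contra! hcon
      have h1 : ({w, o, o'} : Finset (Fin d → S)) ⊆ Q := by
        simp [Finset.insert_subset_iff, hw, ho, ho']
      have h2 := Finset.card_le_card h1
      rw [Finset.card_eq_three.2 ⟨w, o, o', hcon.1, hcon.2, hoo, rfl⟩] at h2
      omega
    have h1 := hc.trace_singleton (hA.twinFree_sec hc v m (x m))
      (x := Function.update o m (v m)) (compat_update (hvQ o ho) (hc.ne _).symm)
      (fun _ ha => sec_compat ha) fun p hp => by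
        have h1 : HitAt A m (x m) p ↔ HitAt (A ∪ Q) m (x m) p := by
          constructor
          · rintro ⟨w, hw, h1, h2⟩
            exact ⟨w, Finset.mem_union_left _ hw, h1, h2⟩
          · rintro ⟨w, hw, h1, h2⟩
            rcases Finset.mem_union.1 hw with hw | hw
            · exact ⟨w, hw, h1, h2⟩
            · rcases hQeq w hw with rfl | rfl
              · exact absurd (hom.symm.trans h1) (hc.ne _)
              · exact absurd (ho'm.symm.trans h1) hxm.symm
        rw [hit_sec hp, h1, hfl _ hxm hxm' p hp, hKQ _ (hc.ne _), inBox_update]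
        constructor
        · exact fun h2 => ⟨o, ho, hom, h2.2⟩
        · rintro ⟨w, hw, h2, h3⟩
          rcases hQeq w hw with rfl | rfl
          · exact ⟨hp m, h3⟩
          · exact absurd (by rw [← ho'm, h2, hc.invol]) hxm'
    have h2 := sec_card_le c A v m (x m)
    have h3 := sum_slice_le A m [x m] (by simp)
    have h4 : 1 < (sec c A v m (x m)).card := by
      have hm : ∀ w ∈ A, Function.update w m (v m) ∈ sec c A v m (x m) := fun w hw =>
        update_mem_sec hw (hAm w hw) (compat_update (hvA w hw) (hc.ne _).symm)
      refine Finset.one_lt_card.2 ⟨_, hm x ((hs.mem x).2 (Or.inl rfl)), _,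
        hm _ ((hs.mem _).2 (Or.inr rfl)), fun h => hc.ne (x k) ?_⟩
      simpa [hmk.symm, hs.ne] using (congrFun h k).symm
    simp only [List.map_cons, List.map_nil, List.sum_cons, List.sum_nil] at h3
    rcases h1 with h1 | h1
    · rw [h1] at h4
      simp at h4
    · omega
  · push Not at hstar
    refine (hc.cover_five hQ fun p hp => ?_).resolve_right (by omega)
    rw [inBox_update] at hp
    have h1 : c (x m) ≠ c (v m) := fun h => hxm (hc.inj h)
    obtain ⟨B, hB, hB', -⟩ := hc.exists_three h1 h1 (hc.ne (c (x m))).symm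
    have h2 : ¬ x m ∈ (B : Set S) := notMem_of_compl B hB'
    rcases h (Function.update p m B) (inBox_update_pt.2 ⟨hB, hp.2⟩) with ⟨a, ha, hap⟩ | ⟨o, ho, hop⟩
    · exact absurd (by simpa [hAm a ha] using hap m) h2
    · rw [inBox_update_pt] at hop
      refine ⟨o, ho, fun n => ?_⟩
      by_cases hn : n = m
      · rcases hQm o ho with h3 | h3 | h3
        · exact absurd h3 (hstar o ho)
        · exact absurd (h3 ▸ hop.1) h2
        · rw [hn, h3]
          exact hp.1
      · exact hop.2 n hn

end SplitPairs

section Regions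

variable {c : S → S} {d : ℕ}

theorem IsComplementation.card_letter [Finite S] (hc : IsComplementation c) (a : S) :
    0 < Nat.card {B : ESet c // a ∈ (B : Set S)} ∧
      2 * Nat.card {B : ESet c // a ∈ (B : Set S)} = Nat.card (ESet c) := by
  classical
  choose K hK using exists_compl (c := c)
  have hKK : ∀ B, K (K B) = B := fun B => by
    ext s
    rw [hK, hK, not_not]
  have h1 : Nat.card {B : ESet c // a ∈ (B : Set S)} =
      Nat.card {B : ESet c // ¬ a ∈ (B : Set S)} :=
    Nat.card_congr
      { toFun := fun B => ⟨K B.1, fun h => (hK _ _).1 h B.2⟩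
        invFun := fun B => ⟨K B.1, (hK _ _).2 B.2⟩
        left_inv := fun B => Subtype.ext (hKK B.1)
        right_inv := fun B => Subtype.ext (hKK B.1) }
  refine ⟨?_, ?_⟩
  · obtain ⟨B, hB, -⟩ := hc.exists_three (hc.ne a).symm (hc.ne a).symm (hc.ne a).symm
    have : Nonempty {B : ESet c // a ∈ (B : Set S)} := ⟨⟨B, hB⟩⟩
    exact Nat.card_pos
  · rw [two_mul]
    nth_rewrite 2 [h1]
    rw [← Nat.card_sum]
    exact Nat.card_congr (Equiv.sumCompl fun B : ESet c => a ∈ (B : Set S))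

theorem IsComplementation.card_box [Finite S] (hc : IsComplementation c) (v : Fin d → S) :
    Nat.card {p : Pt c d // InBox v p} = (Nat.card (ESet c) / 2) ^ d := by
  change Nat.card {p : Pt c d // ∀ i, v i ∈ (p i : Set S)} = _
  rw [Nat.card_congr (Equiv.subtypePiEquivPi (p := fun i (B : ESet c) => v i ∈ (B : Set S))),
    Nat.card_pi]
  simp_rw [fun i => show Nat.card {B : ESet c // v i ∈ (B : Set S)} = Nat.card (ESet c) / 2 by
    have := (hc.card_letter (v i)).2
    omega]
  simp

theorem IsComplementation.card_hit [Finite S] (hc : IsComplementation c)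
    {V : Finset (Fin d → S)} (hV : PolyboxCode c (V : Set (Fin d → S))) :
    Nat.card {p : Pt c d // Hit V p} = V.card * (Nat.card (ESet c) / 2) ^ d := by
  classical
  have : Fintype (Pt c d) := Fintype.ofFinite _
  have h1 : (Finset.univ.filter fun p : Pt c d => Hit V p) =
      V.biUnion fun v => Finset.univ.filter fun p : Pt c d => InBox v p := by
    ext p
    simp only [Finset.mem_filter, Finset.mem_biUnion, Finset.mem_univ, true_and]
    rfl
  rw [Nat.card_eq_fintype_card, Fintype.card_subtype, h1, Finset.card_biUnion]
  · refine Finset.sum_const_nat fun v _ => ?_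
    rw [← hc.card_box v, Nat.card_eq_fintype_card, Fintype.card_subtype]
  · intro u hu v hv huv
    refine Finset.disjoint_left.2 fun p h1 h2 => huv ?_
    exact code_unique hV hu hv (Finset.mem_filter.1 h1).2 (Finset.mem_filter.1 h2).2

theorem SameRegion.card_eq [Finite S] (hc : IsComplementation c) {V W : Finset (Fin d → S)}
    (hV : PolyboxCode c (V : Set (Fin d → S))) (hW : PolyboxCode c (W : Set (Fin d → S)))
    (h : SameRegion c V W) : V.card = W.card := by
  have h1 : Nat.card {p : Pt c d // Hit V p} = Nat.card {p : Pt c d // Hit W p} :=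
    Nat.card_congr (Equiv.subtypeEquivRight h)
  rw [hc.card_hit hV, hc.card_hit hW] at h1
  by_cases hS : Nonempty (Fin d → S)
  · obtain ⟨v⟩ := hS
    obtain ⟨p, hp, -⟩ := hc.exists_common₂ (hc.compat_self v)
    have : Nonempty {p : Pt c d // InBox v p} := ⟨⟨p, hp⟩⟩
    have h2 : 0 < Nat.card {p : Pt c d // InBox v p} := Nat.card_pos
    rw [hc.card_box v] at h2
    exact Nat.eq_of_mul_eq_mul_right h2 h1
  · have hemp : ∀ A : Finset (Fin d → S), A = ∅ := fun A =>
      Finset.eq_empty_of_forall_notMem fun a _ => hS ⟨a⟩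
    rw [hemp V, hemp W]

theorem SameRegion.symm {V W : Finset (Fin d → S)} (h : SameRegion c V W) : SameRegion c W V :=
  fun p => (h p).symm

/-- Twin-free codes with fewer than `n` words are rigid. -/
def RigidBelow (c : S → S) (d n : ℕ) : Prop :=
  ∀ V W : Finset (Fin d → S), V.card < n → TwinFreeCode c V →
    PolyboxCode c (W : Set (Fin d → S)) → SameRegion c V W → W = V

theorem hit_erase [DecidableEq S] {V : Finset (Fin d → S)}
    (hV : PolyboxCode c (V : Set (Fin d → S))) {x : Fin d → S} (hx : x ∈ V) {p : Pt c d} :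
    Hit (V.erase x) p ↔ Hit V p ∧ ¬ InBox x p := by
  constructor
  · rintro ⟨v, hv, hvp⟩
    rw [Finset.mem_erase] at hv
    exact ⟨⟨v, hv.2, hvp⟩, fun h => hv.1 (code_unique hV hv.2 hx hvp h)⟩
  · rintro ⟨⟨v, hv, hvp⟩, h⟩
    exact ⟨v, Finset.mem_erase.2 ⟨fun h' => h (h' ▸ hvp), hv⟩, hvp⟩

theorem RigidBelow.disjoint {n : ℕ} (ih : RigidBelow c d n)
    {V W : Finset (Fin d → S)} (hn : V.card = n) (hV : TwinFreeCode c V)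
    (hW : PolyboxCode c (W : Set (Fin d → S))) (h : SameRegion c V W) (hne : W ≠ V)
    {x : Fin d → S} (hxV : x ∈ V) (hxW : x ∈ W) : False := by
  classical
  refine hne ?_
  have h1 := ih (V.erase x) (W.erase x) (by rw [← hn]; exact Finset.card_erase_lt_of_mem hxV)
    (hV.mono (V.erase_subset x))
    (fun u hu v hv => hW u (Finset.mem_of_mem_erase hu) v (Finset.mem_of_mem_erase hv))
    fun p => by rw [hit_erase hV.code hxV, hit_erase hW hxW, h p]
  rw [← Finset.insert_erase hxW, h1, Finset.insert_erase hxV]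

/-- A twin pair in a code can be replaced by any other twin pair in the same direction. -/
theorem IsComplementation.exists_swap [Finite S] (hc : IsComplementation c)
    {V W : Finset (Fin d → S)} (hW : PolyboxCode c (W : Set (Fin d → S))) (h : SameRegion c V W)
    {w : Fin d → S} {i : Fin d} (hw : w ∈ W) (hw' : Function.update w i (c (w i)) ∈ W) (s : S) :
    ∃ T : Finset (Fin d → S), PolyboxCode c (T : Set (Fin d → S)) ∧ SameRegion c V T ∧
      Function.update w i s ∈ T ∧ Function.update w i (c s) ∈ T := by
  classical
  have hmem : ∀ (s : S) (p : Pt c d), InBox (Function.update w i s) p ∨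
      InBox (Function.update w i (c s)) p ↔ ∀ n, n ≠ i → w n ∈ (p n : Set S) := by
    intro s p
    rw [inBox_update, inBox_update]
    by_cases h1 : s ∈ (p i : Set S)
    · simp [h1]
    · simp [compl_mem _ h1]
  have hcap : ∀ (s : S) (p : Pt c d), ¬ (InBox (Function.update w i s) p ∧
      InBox (Function.update w i (c s)) p) := fun s p h => by
    rw [inBox_update, inBox_update] at h
    exact compl_notMem _ h.1.1 h.2.1
  have hww : Function.update w i (w i) = w := Function.update_eq_self _ _
  have hne : Function.update w i (c (w i)) ≠ w := fun h => hc.ne (w i) (by simpa using congrFun h i)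
  set R := (W.erase w).erase (Function.update w i (c (w i))) with hR
  have hRW : ∀ u, u ∈ R ↔ u ∈ W ∧ u ≠ w ∧ u ≠ Function.update w i (c (w i)) := fun u => by
    simp only [hR, Finset.mem_erase]
    tauto
  set T := insert (Function.update w i s) (insert (Function.update w i (c s)) R) with hT
  have hTmem : ∀ u, u ∈ T ↔ u = Function.update w i s ∨ u = Function.update w i (c s) ∨ u ∈ R :=
    fun u => by simp [hT]
  have hTT : ∀ u ∈ R, ∀ t, (t = s ∨ t = c s) → Dicho c u (Function.update w i t) := by
    intro u hu t ht
    by_contra hcon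
    obtain ⟨p, hp1, hp2⟩ := hc.exists_common₂ hcon
    have h1 := (hmem (w i) p).2 ((hmem s p).1 (by rcases ht with rfl | rfl <;> tauto))
    rw [hww] at h1
    obtain ⟨h2, h3, h4⟩ := (hRW u).1 hu
    rcases h1 with h1 | h1
    · exact h3 (code_unique hW h2 hw hp1 h1)
    · exact h4 (code_unique hW h2 hw' hp1 h1)
  have hss : Dicho c (Function.update w i s) (Function.update w i (c s)) := ⟨i, by simp⟩
  have hTc : PolyboxCode c (T : Set (Fin d → S)) := by
    intro u hu v hv huv
    rw [Finset.mem_coe, hTmem] at hu hv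
    rcases hu with rfl | rfl | hu <;> rcases hv with rfl | rfl | hv
    · exact absurd rfl huv
    · exact hss
    · exact hc.dicho_symm (hTT v hv _ (Or.inl rfl))
    · exact hc.dicho_symm hss
    · exact absurd rfl huv
    · exact hc.dicho_symm (hTT v hv _ (Or.inr rfl))
    · exact hTT u hu _ (Or.inl rfl)
    · exact hTT u hu _ (Or.inr rfl)
    · exact hW u ((hRW u).1 hu).1 v ((hRW v).1 hv).1 huv
  have hTr : SameRegion c V T := by
    intro p
    rw [h p]
    have h1 := (hmem (w i) p).trans (hmem s p).symm
    rw [hww] at h1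
    constructor
    · rintro ⟨u, hu, hup⟩
      have h2 : (InBox w p ∨ InBox (Function.update w i (c (w i))) p) → Hit T p := fun h2 => by
        rcases h1.1 h2 with h2 | h2
        · exact ⟨_, (hTmem _).2 (Or.inl rfl), h2⟩
        · exact ⟨_, (hTmem _).2 (Or.inr (Or.inl rfl)), h2⟩
      by_cases h3 : u = w
      · exact h2 (Or.inl (h3 ▸ hup))
      · by_cases h4 : u = Function.update w i (c (w i))
        · exact h2 (Or.inr (h4 ▸ hup))
        · exact ⟨u, (hTmem u).2 (Or.inr (Or.inr ((hRW u).2 ⟨hu, h3, h4⟩))), hup⟩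
    · rintro ⟨u, hu, hup⟩
      have h2 : (InBox (Function.update w i s) p ∨ InBox (Function.update w i (c s)) p) →
          Hit W p := fun h2 => by
        rcases h1.2 h2 with h2 | h2
        · exact ⟨_, hw, h2⟩
        · exact ⟨_, hw', h2⟩
      rcases (hTmem u).1 hu with rfl | rfl | hu
      · exact h2 (Or.inl hup)
      · exact h2 (Or.inr hup)
      · exact ⟨u, ((hRW u).1 hu).1, hup⟩
  exact ⟨T, hTc, hTr, (hTmem _).2 (Or.inl rfl), (hTmem _).2 (Or.inr (Or.inl rfl))⟩

theorem RigidBelow.swap_notMem [Finite S] (hc : IsComplementation c) {n : ℕ}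
    (ih : RigidBelow c d n) {V W : Finset (Fin d → S)} (hn : V.card = n) (hV : TwinFreeCode c V)
    (hW : PolyboxCode c (W : Set (Fin d → S))) (h : SameRegion c V W)
    {w : Fin d → S} {i : Fin d} (hw : w ∈ W) (hw' : Function.update w i (c (w i)) ∈ W) (s : S) :
    Function.update w i s ∉ V := by
  intro hs
  obtain ⟨T, hTc, hTr, h1, h2⟩ := hc.exists_swap hW h hw hw' s
  refine ih.disjoint hn hV hTc hTr ?_ hs h1
  rintro rfl
  exact hV.noTwin _ h1 _ h2 ⟨i, by simp, fun n hn => by simp [hn]⟩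

/-- Comparison of the layers of two codes at a pair of complementary letters. -/
theorem SameRegion.hitAt [Finite S] (hc : IsComplementation c) {V W : Finset (Fin d → S)}
    (hV : PolyboxCode c (V : Set (Fin d → S))) (hW : PolyboxCode c (W : Set (Fin d → S)))
    (h : SameRegion c V W) (i : Fin d) (s : S) (p : Pt c d) :
    ∃ P Q : Prop, (HitAt V i s p ∨ P ↔ HitAt W i s p ∨ Q) ∧
      (HitAt V i (c s) p ∨ P ↔ HitAt W i (c s) p ∨ Q) ∧
      ¬ (HitAt V i s p ∧ P) ∧ ¬ (HitAt V i (c s) p ∧ P) ∧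
      ¬ (HitAt W i s p ∧ Q) ∧ ¬ (HitAt W i (c s) p ∧ Q) := by
  obtain ⟨B, hB, -⟩ := hc.exists_three (hc.ne s).symm (hc.ne s).symm (hc.ne s).symm
  obtain ⟨B', h1, h2⟩ := hc.exists_flip B s
  have h0 : s ∉ (B' : Set S) := notMem_of_compl B' h1
  have key : ∀ {K : Finset (Fin d → S)}, PolyboxCode c (K : Set (Fin d → S)) →
      ∃ P : Prop, (Hit K (Function.update p i B) ↔ HitAt K i s p ∨ P) ∧
        (Hit K (Function.update p i B') ↔ HitAt K i (c s) p ∨ P) ∧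
        ¬ (HitAt K i s p ∧ P) ∧ ¬ (HitAt K i (c s) p ∧ P) := by
    intro K hK
    refine ⟨∃ w ∈ K, w i ≠ s ∧ w i ≠ c s ∧ InBox w (Function.update p i B), ?_, ?_, ?_, ?_⟩
    · constructor
      · rintro ⟨w, hw, hwp⟩
        by_cases h3 : w i = s
        · exact Or.inl ⟨w, hw, h3, (inBox_update_pt.1 hwp).2⟩
        · exact Or.inr ⟨w, hw, h3, fun h4 =>
            compl_notMem B hB (h4 ▸ (inBox_update_pt.1 hwp).1), hwp⟩
      · rintro (⟨w, hw, h3, h4⟩ | ⟨w, hw, -, -, h3⟩)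
        · exact ⟨w, hw, inBox_update_pt.2 ⟨h3 ▸ hB, h4⟩⟩
        · exact ⟨w, hw, h3⟩
    · constructor
      · rintro ⟨w, hw, hwp⟩
        rw [inBox_update_pt] at hwp
        by_cases h3 : w i = c s
        · exact Or.inl ⟨w, hw, h3, hwp.2⟩
        · have h4 : w i ≠ s := fun h4 => h0 (h4 ▸ hwp.1)
          exact Or.inr ⟨w, hw, h4, h3, inBox_update_pt.2 ⟨(h2 _ h4 h3).1 hwp.1, hwp.2⟩⟩
      · rintro (⟨w, hw, h3, h4⟩ | ⟨w, hw, h3, h4, h5⟩)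
        · exact ⟨w, hw, inBox_update_pt.2 ⟨h3 ▸ h1, h4⟩⟩
        · rw [inBox_update_pt] at h5
          exact ⟨w, hw, inBox_update_pt.2 ⟨(h2 _ h3 h4).2 h5.1, h5.2⟩⟩
    · rintro ⟨⟨w, hw, h3, h4⟩, u, hu, h5, -, h6⟩
      refine h5 ?_
      rw [code_unique hK hu hw h6 (inBox_update_pt.2 ⟨h3 ▸ hB, h4⟩), h3]
    · rintro ⟨⟨w, hw, h3, h4⟩, u, hu, h5, h5', h6⟩
      rw [inBox_update_pt] at h6
      refine h5' ?_
      rw [code_unique (p := Function.update p i B') hK hu hw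
        (inBox_update_pt.2 ⟨(h2 _ h5 h5').2 h6.1, h6.2⟩) (inBox_update_pt.2 ⟨h3 ▸ h1, h4⟩), h3]
  obtain ⟨P, hP1, hP2, hP3, hP4⟩ := key hV
  obtain ⟨Q, hQ1, hQ2, hQ3, hQ4⟩ := key hW
  exact ⟨P, Q, by rw [← hP1, ← hQ1, h], by rw [← hP2, ← hQ2, h], hP3, hP4, hQ3, hQ4⟩

end Regions

section TwinsInW

variable {c : S → S} {d : ℕ}

theorem IsComplementation.exists_mem_letter [Finite S] (hc : IsComplementation c) (a : S) :
    ∃ B : ESet c, a ∈ (B : Set S) := by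
  obtain ⟨B, hB, -⟩ := hc.exists_three (hc.ne a).symm (hc.ne a).symm (hc.ne a).symm
  exact ⟨B, hB⟩

theorem IsComplementation.exists_mem_letters [Finite S] (hc : IsComplementation c) {a b : S}
    (h : b ≠ c a) : ∃ B : ESet c, a ∈ (B : Set S) ∧ b ∈ (B : Set S) := by
  obtain ⟨B, hB, hB', -⟩ := hc.exists_three h h (hc.ne _).symm
  exact ⟨B, hB, hB'⟩

theorem IsComplementation.not_hitAt_hitAt [Finite S] (hc : IsComplementation c)
    {K : Finset (Fin d → S)} (hK : PolyboxCode c (K : Set (Fin d → S))) {i : Fin d} {s t : S}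
    (h1 : t ≠ s) (h2 : t ≠ c s) {p : Pt c d} (hs : HitAt K i s p) (ht : HitAt K i t p) : False := by
  obtain ⟨B, hB, hB'⟩ := hc.exists_mem_letters h2
  obtain ⟨u, hu, hus, hup⟩ := hs
  obtain ⟨v, hv, hvt, hvp⟩ := ht
  have h3 := code_unique (p := Function.update p i B) hK hu hv
    (inBox_update_pt.2 ⟨hus ▸ hB, hup⟩) (inBox_update_pt.2 ⟨hvt ▸ hB', hvp⟩)
  exact h1 (by rw [← hus, ← hvt, h3])

/-- Two words of a code with compatible letters at `i` are dichotomous elsewhere. -/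
theorem exists_dicho_off {K : Finset (Fin d → S)} (hK : PolyboxCode c (K : Set (Fin d → S)))
    {u v : Fin d → S} (hu : u ∈ K) (hv : v ∈ K) (huv : u ≠ v) {i : Fin d} (hi : v i ≠ c (u i)) :
    ∃ j, j ≠ i ∧ v j = c (u j) := by
  obtain ⟨j, hj⟩ := hK u hu v hv huv
  refine ⟨j, ?_, hj⟩
  rintro rfl
  exact hi hj

theorem sec_pos {K : Finset (Fin d → S)} {u v : Fin d → S} {i : Fin d} (hv : v ∈ K)
    {p : Pt c d} (hu : InBox u p) (hvp : ∀ n, n ≠ i → v n ∈ (p n : Set S)) :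
    0 < (sec c K u i (v i)).card := by
  obtain ⟨w, hw, -⟩ := (hit_sec (c := c) hu).2 ⟨v, hv, rfl, hvp⟩
  exact Finset.card_pos.2 ⟨w, hw⟩

theorem sum_sec_le (K : Finset (Fin d → S)) (u : Fin d → S) (i : Fin d) (l : List S)
    (hl : l.Nodup) : (l.map fun s => (sec c K u i s).card).sum ≤ K.card :=
  (List.sum_le_sum fun s _ => sec_card_le c K u i s).trans (sum_slice_le K i l hl)

theorem RigidBelow.two_pairs [Finite S] (hc : IsComplementation c) {n : ℕ}
    (ih : RigidBelow c d n) {V : Finset (Fin d → S)} (hn : V.card = n) (h9 : n ≤ 9)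
    (hV : TwinFreeCode c V) {u : Fin d → S} {i : Fin d}
    (hsw : ∀ q, ∃ T : Finset (Fin d → S), PolyboxCode c (T : Set (Fin d → S)) ∧ SameRegion c V T ∧
      Function.update u i q ∈ T ∧ Function.update u i (c q) ∈ T)
    (hflip : ∀ p : Pt c d, InBox u p → ∀ f, (HitAt V i f p ↔ HitAt V i (c f) p))
    {s q : S} (hqs : q ≠ s) (hqs' : q ≠ c s) (hs2 : (sec c V u i s).card = 2)
    (hs2' : (sec c V u i (c s)).card = 2) (hq2 : (sec c V u i q).card = 2)
    (hq2' : 2 ≤ (sec c V u i (c q)).card) : False := by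
  have hcq : c q ≠ c s := fun h => hqs (hc.inj h)
  have hcq' : c q ≠ s := fun h => hqs' (by rw [← h, hc.invol])
  have hnd : [s, c s, q, c q].Nodup := by
    simp [(hc.ne s).symm, (hc.ne q).symm, hqs.symm, hqs'.symm, hcq.symm, hcq'.symm]
  have hsum := sum_sec_le (c := c) V u i _ hnd
  simp only [List.map_cons, List.map_nil, List.sum_cons, List.sum_nil] at hsum
  have hletters : ∀ t, 0 < (sec c V u i t).card → t = s ∨ t = c s ∨ t = q ∨ t = c q := by
    intro t ht
    by_contra! hcon
    obtain ⟨h1, h2, h3, h4⟩ := hcon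
    have h5 := hV.sec_trace_card hc (v := u) (i := i) (s := t) fun p hp => hflip p hp t
    have h1' : c t ≠ s := fun h => h2 (by rw [← h, hc.invol])
    have h2' : c t ≠ c s := fun h => h1 (hc.inj h)
    have h3' : c t ≠ q := fun h => h4 (by rw [← h, hc.invol])
    have h4' : c t ≠ c q := fun h => h3 (hc.inj h)
    have h6 := sum_sec_le (c := c) V u i (t :: c t :: [s, c s, q, c q]) (by
      refine List.nodup_cons.2 ⟨?_, List.nodup_cons.2 ⟨?_, hnd⟩⟩
      · simp [h1, h2, h3, h4, (hc.ne t).symm]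
      · simp [h1', h2', h3', h4'])
    simp only [List.map_cons, List.map_nil, List.sum_cons, List.sum_nil] at h6
    omega
  have hcov : ∀ p : Pt c d, ∀ B, InBox u p → Hit V (Function.update p i B) := by
    intro p B hp
    obtain ⟨T, -, hT, h1, h2⟩ := hsw (u i)
    rw [hT]
    by_cases hB : u i ∈ (B : Set S)
    · exact ⟨_, h1, inBox_update_pt.2 ⟨by simpa using hB, fun n hn => by simpa [hn] using hp n⟩⟩
    · exact ⟨_, h2, inBox_update_pt.2
        ⟨by simpa using compl_mem B hB, fun n hn => by simpa [hn] using hp n⟩⟩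
  have hor : ∀ r, r ≠ s → r ≠ c s → (r = q ∨ r = c q) → ∀ p : Pt c d, InBox u p →
      (HitAt V i r p ↔ ¬ HitAt V i s p) := by
    intro r h1 h2 h3 p hp
    refine ⟨fun h4 h5 => hc.not_hitAt_hitAt hV.code h1 h2 h5 h4, fun h4 => ?_⟩
    obtain ⟨B, hB, hB'⟩ := hc.exists_mem_letters h2
    obtain ⟨v, hv, hvp⟩ := hcov p B hp
    rw [inBox_update_pt] at hvp
    have h5 := hletters _ (sec_pos hv hp hvp.2)
    have h6 : v i ≠ c s := fun h => compl_notMem B hB (h ▸ hvp.1)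
    have h7 : v i ≠ c r := fun h => compl_notMem B hB' (h ▸ hvp.1)
    have h8 : v i ≠ s := fun h => h4 ⟨v, hv, h, hvp.2⟩
    refine ⟨v, hv, ?_, hvp.2⟩
    rcases h3 with rfl | rfl
    · tauto
    · rw [hc.invol] at h7
      tauto
  obtain ⟨x, k, l, hsp⟩ := hc.exists_splitPair (hV.twinFree_sec hc u i s)
    (hV.twinFree_sec hc u i (c s)) hs2 hs2' (fun _ h => sec_compat h) (fun _ h => sec_compat h)
    (fun _ h1 h2 => hV.sec_disjoint h1 h2)
    fun p hp => (hit_sec hp).trans ((hflip p hp s).trans (hit_sec hp).symm)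
  have hxA := (hsp.mem x).2 (Or.inl rfl)
  by_cases htriv : ∀ n, n ≠ k → n ≠ l → x n = u n
  · have h1 := fun r (h1 : r ≠ s) (h2 : r ≠ c s) (h3 : r = q ∨ r = c q)
        (h5 : (sec c V u i r).card < 5) =>
      hsp.mem_of_trivial hc (fun _ h => sec_compat h) htriv (hV.twinFree_sec hc u i r) h5
        (fun _ h => sec_compat h) fun p hp => by
          rw [hit_sec hp, hit_sec hp]
          exact hor r h1 h2 h3 p hp
    exact hV.sec_disjoint (h1 q hqs hqs' (Or.inl rfl) (by omega))
      (h1 (c q) hcq' hcq (Or.inr rfl) (by omega))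
  push Not at htriv
  obtain ⟨m, hmk, hml, hxm⟩ := htriv
  have hmi : m ≠ i := by
    rintro rfl
    exact hxm (mem_sec.1 hxA).1
  have hxm' : x m ≠ c (u m) := fun h => sec_compat hxA ⟨m, h⟩
  have hD := fun r (h1 : r ≠ s) (h2 : r ≠ c s) (h3 : r = q ∨ r = c q)
      (h5 : (sec c V u i r).card ≤ 2) =>
    hsp.mem_of_nontrivial hc (hV.twinFree_sec hc u i s) hs2 (fun _ h => sec_compat h) hmk hml hxm
      (hV.twinFree_sec hc u i r) h5 (fun _ h => sec_compat h) (fun a ha b hb => by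
        have ha := mem_sec.1 ha
        have hb := mem_sec.1 hb
        obtain ⟨j, hj, hj'⟩ := exists_dicho_off hV.code ha.2.1 hb.2.1 (i := i)
          (fun h => h1 (by simpa using (congrFun h i).symm)) (by simpa using h2)
        exact ⟨j, by simpa [hj] using hj'⟩) fun p hp => by
        rw [hit_sec hp, hit_sec hp, hor r h1 h2 h3 p hp]
        exact Classical.em _
  have hω := hD q hqs hqs' (Or.inl rfl) (by omega)
  have hq3 : (sec c V u i (c q)).card = 3 := by
    by_contra h3
    exact hV.sec_disjoint hω (hD (c q) hcq' hcq (Or.inr rfl) (by omega))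
  have hωV := (mem_sec.1 hω).2.1
  have hslices := sum_slice_le V i _ hnd
  simp only [List.map_cons, List.map_nil, List.sum_cons, List.sum_nil] at hslices
  have e1 := sec_card_le c V u i s
  have e2 := sec_card_le c V u i (c s)
  have e3 := sec_card_le c V u i q
  have e4 := sec_card_le c V u i (c q)
  have hVi : ∀ v ∈ V, v i = s ∨ v i = c s ∨ v i = q ∨ v i = c q := by
    intro v hv
    by_contra! hcon
    obtain ⟨h1, h2, h3, h4⟩ := hcon
    have h5 := sum_slice_le V i (v i :: [s, c s, q, c q])
      (List.nodup_cons.2 ⟨by simp [h1, h2, h3, h4], hnd⟩)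
    have h6 : 0 < (slice V i (v i)).card := Finset.card_pos.2 ⟨v, mem_slice.2 ⟨hv, rfl⟩⟩
    simp only [List.map_cons, List.map_nil, List.sum_cons, List.sum_nil] at h5
    omega
  have hVu : ∀ v ∈ V, ¬ Dicho c u (Function.update v i (u i)) := by
    intro v hv
    rcases hVi v hv with h | h | h | h <;>
      exact compat_of_slice_card_le (by omega) hv h
  have hVu' : ∀ v ∈ V, ∀ j, j ≠ i → v j ≠ c (u j) := fun v hv j hj h =>
    hVu v hv ⟨j, by simpa [hj] using h⟩
  set ω := Function.update (Function.update u m (c (x m))) i q with hω'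
  have hVs : ∀ v ∈ V, v i = c q ∨ v = ω ∨ v m = x m := by
    intro v hv
    rcases hVi v hv with h | h | h | h
    · have h1 := update_mem_sec hv h (hVu v hv)
      refine Or.inr (Or.inr ?_)
      rcases (hsp.mem _).1 h1 with h1 | h1
      · simpa [hmi] using congrFun h1 m
      · simpa [hmi, hmk, hml] using congrFun h1 m
    · have h1 := update_mem_sec hv h (hVu v hv)
      refine Or.inr (Or.inr ?_)
      rcases (hsp.mem' _).1 h1 with h1 | h1
      · simpa [hmi, hmk] using congrFun h1 m
      · simpa [hmi, hmk, hml] using congrFun h1 m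
    · refine Or.inr (or_iff_not_imp_left.2 fun h1 => ?_)
      obtain ⟨j, hj, hj'⟩ := exists_dicho_off hV.code hωV hv (Ne.symm h1) (i := i)
        (by simpa [h, hω'] using (hc.ne q).symm)
      by_cases hjm : j = m
      · rw [hjm] at hj'
        simpa [hω', hmi, hc.invol] using hj'
      · exact absurd (by simpa [hω', hj, hjm] using hj') (hVu' v hv j hj)
    · exact Or.inl h
  obtain ⟨T, hT, hTr, hTq, hTq'⟩ := hsw q
  have hωm : ω m = c (x m) := by simp [hω', hmi]
  have hωi : ω i = q := by simp [hω']
  have hωn : ∀ n, n ≠ i → n ≠ m → ω n = u n := fun n h1 h2 => by simp [hω', h1, h2]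
  have h1 : u m ≠ c (x m) := hc.ne_comm hxm'
  have h2 : u m ≠ c (c (x m)) := by rw [hc.invol]; exact hxm.symm
  obtain ⟨p, hp, -⟩ := hc.exists_common₂ (hc.compat_self ω)
  obtain ⟨r, hr, hrm, hrp⟩ := (hc.hitAt_compl_of_cover (u := ω) (i := m) hT
    (fun p hp => (hTr p).1 ⟨ω, hωV, hp⟩) (hωm ▸ h1) (hωm ▸ h2) hp).1
    ⟨_, hTq, by simp [hmi], fun n hn => by
      by_cases hni : n = i
      · have := hp i
        rw [hωi] at this
        rw [hni]
        simpa using this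
      · have := hp n
        rw [hωn n hni hn] at this
        simpa [hni] using this⟩
  have hri : r i ≠ c q := by
    intro h
    have h3 := hrp i hmi.symm
    have h4 := hp i
    rw [hωi] at h4
    exact compl_notMem _ h4 (h ▸ h3)
  have hBm : ∃ B : ESet c, c (u m) ∈ (B : Set S) ∧ c (x m) ∈ (B : Set S) :=
    hc.exists_mem_letters fun h => hxm' (hc.inj h)
  obtain ⟨Bm, hBm, hBm'⟩ := hBm
  have hxB : x m ∉ (Bm : Set S) := notMem_of_compl Bm hBm'
  have huB : u m ∉ (Bm : Set S) := notMem_of_compl Bm hBm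
  have hrn : ∀ n, n ≠ i → n ≠ m → r n = u n := by
    intro n hni hnm
    by_contra hne
    obtain ⟨Bi, hBi, hBi'⟩ := hc.exists_mem_letters hri
    obtain ⟨Bn, hBn, hBn'⟩ := hc.exists_mem_letters (a := c (u n)) (b := r n)
      (by rw [hc.invol]; exact hne)
    obtain ⟨p, hp, -⟩ := hc.exists_common₂ (hc.compat_self r)
    obtain ⟨v, hv, hvp⟩ :=
      (hTr (Function.update (Function.update (Function.update p n Bn) m Bm) i Bi)).2
      ⟨r, hr, by
        refine inBox_update_pt.2 ⟨hBi', fun j hj => ?_⟩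
        by_cases hjm : j = m
        · rw [hjm, Function.update_self, hrm]
          exact hBm
        · rw [Function.update_of_ne hjm]
          by_cases hjn : j = n
          · rw [hjn, Function.update_self]
            exact hBn'
          · rw [Function.update_of_ne hjn]
            exact hp j⟩
    have hvi := hvp i
    have hvm := hvp m
    have hvn := hvp n
    simp only [Function.update_self, Function.update_of_ne hmi, Function.update_of_ne hni,
      Function.update_of_ne hnm] at hvi hvm hvn
    rcases hVs v hv with h | h | h
    · exact compl_notMem Bi hBi (h ▸ hvi)
    · rw [h, hωn n hni hnm] at hvn
      exact notMem_of_compl Bn hBn hvn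
    · exact hxB (h ▸ hvm)
  have hreq : ∀ n, n ≠ i → r n = Function.update u m (c (u m)) n := by
    intro n hn
    by_cases hnm : n = m
    · rw [hnm, hrm, Function.update_self]
    · rw [hrn n hn hnm, Function.update_of_ne hnm]
  by_cases hriq : r i = q
  · refine ih.swap_notMem hc hn hV hT hTr (i := m) hTq ?_ (c (x m)) ?_
    · convert hr using 1
      funext n
      by_cases hni : n = i
      · simp [hni, hmi.symm, hriq]
      · rw [hreq n hni]
        by_cases hnm : n = m
        · simp [hnm, hmi]
        · simp [hnm, hni]
    · rw [Function.update_comm hmi.symm]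
      exact hωV
  · have hζ : Function.update (Function.update u m (c (x m))) i (c q) ∈
        slice (slice V m (c (x m))) i (c q) := by
      have hsub : slice (slice V m (c (x m))) i (c q) ⊆ V := fun w hw =>
        (mem_slice.1 (mem_slice.1 hw).1).1
      have hcard : (slice (slice V m (c (x m))) i (c q)).card ≤ (slice V i (c q)).card :=
        Finset.card_le_card fun w hw => mem_slice.2 ⟨hsub hw, (mem_slice.1 hw).2⟩
      refine (hc.cover_five (hV.mono hsub) fun p hp => ?_).resolve_right (by omega)
      obtain ⟨Bi, hBi, hBi'⟩ := hc.exists_mem_letters (a := c q) (b := r i)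
        (by rw [hc.invol]; exact hriq)
      rw [inBox_update] at hp
      obtain ⟨v, hv, hvp⟩ := (hTr (Function.update (Function.update p m Bm) i Bi)).2
        ⟨r, hr, by
          refine inBox_update_pt.2 ⟨hBi', fun j hj => ?_⟩
          by_cases hjm : j = m
          · rw [hjm, Function.update_self, hrm]
            exact hBm
          · rw [Function.update_of_ne hjm]
            have := hp.2 j hj
            rwa [Function.update_of_ne hjm, ← hrn j hj hjm] at this⟩
      have hvi := hvp i
      have hvm := hvp m
      simp only [Function.update_self, Function.update_of_ne hmi] at hvi hvm
      have hvq : v i = c q := by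
        rcases hVs v hv with h | h | h
        · exact h
        · rw [h, hωi] at hvi
          exact absurd hvi (notMem_of_compl Bi hBi)
        · exact absurd (h ▸ hvm) hxB
      have hvmx : v m = c (x m) := by
        by_contra hne
        have g1 : v m ≠ x m := fun h => hxB (h ▸ hvm)
        have g2 : v m ≠ u m := fun h => huB (h ▸ hvm)
        have g3 := hVu' v hv m hmi
        have g4 : c (v m) ≠ x m := fun h => hne (by rw [← h, hc.invol])
        have g5 : c (v m) ≠ c (x m) := fun h => g1 (hc.inj h)
        have hsl : ∀ f, f ≠ x m → f ≠ c (x m) → (slice V m f).card ≤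
            (slice (slice V i (c q)) m f).card := by
          intro f f1 f2
          refine Finset.card_le_card fun w hw => ?_
          rw [mem_slice] at hw
          refine mem_slice.2 ⟨mem_slice.2 ⟨hw.1, ?_⟩, hw.2⟩
          rcases hVs w hw.1 with h | h | h
          · exact h
          · exact absurd (by rw [← hw.2, h, hωm]) f2
          · exact absurd (by rw [← hw.2, h]) f1
        have k1 := hsl _ g1 hne
        have k2 := hsl _ g4 g5
        have k3 := sum_slice_le (slice V i (c q)) m [v m, c (v m)] (by simpa using (hc.ne _).symm)
        simp only [List.map_cons, List.map_nil, List.sum_cons, List.sum_nil] at k3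
        have hum : Function.update u i (c q) m = u m := by simp [hmi]
        have k4 := hV.sec_trace_card hc (v := Function.update u i (c q)) (i := m) (s := v m)
          fun p hp => hc.hitAt_compl_of_cover hV.code (fun p hp => (hTr p).2 ⟨_, hTq', hp⟩)
            (by rwa [hum]) (by rwa [hum]) hp
        have k5 := sec_card_le c V (Function.update u i (c q)) m (v m)
        have k6 := sec_card_le c V (Function.update u i (c q)) m (c (v m))
        have k7 : 0 < (sec c V (Function.update u i (c q)) m (v m)).card :=
          Finset.card_pos.2 ⟨_, update_mem_sec hv rfl (by
            rintro ⟨j, hj⟩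
            by_cases hjm : j = m
            · rw [hjm, Function.update_self] at hj
              exact hc.ne _ hj.symm
            · rw [Function.update_of_ne hjm] at hj
              by_cases hji : j = i
              · rw [hji, hvq, Function.update_self] at hj
                exact hc.ne _ hj.symm
              · rw [Function.update_of_ne hji] at hj
                exact hVu' v hv j hji hj)⟩
        omega
      refine ⟨v, mem_slice.2 ⟨mem_slice.2 ⟨hv, hvmx⟩, hvq⟩, fun j => ?_⟩
      by_cases hji : j = i
      · rw [hji, hvq]
        exact hp.1
      · by_cases hjm : j = m
        · have := hp.2 m hmi
          rw [Function.update_self] at this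
          rwa [hjm, hvmx]
        · have := hvp j
          rwa [Function.update_of_ne hji, Function.update_of_ne hjm] at this
    exact hV.noTwin _ hωV _ (mem_slice.1 (mem_slice.1 hζ).1).1
      ⟨i, by simp [hω'], fun n hn => by simp [hω', hn]⟩

/-- A code equivalent to a minimal non-rigid twin-free code is twin-free. -/
theorem RigidBelow.twinFree [Finite S] (hc : IsComplementation c) {n : ℕ}
    (ih : RigidBelow c d n) {V W : Finset (Fin d → S)} (hn : V.card = n) (h9 : n ≤ 9)
    (hV : TwinFreeCode c V) (hW : PolyboxCode c (W : Set (Fin d → S))) (h : SameRegion c V W) :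
    TwinFreeCode c W := by
  refine ⟨hW, fun u hu w hw ⟨i, hi, hoff⟩ => ?_⟩
  have hw' : Function.update u i (c (u i)) ∈ W := by
    convert Finset.mem_coe.1 hw using 1
    funext j
    by_cases hj : j = i
    · rw [hj, hi, Function.update_self]
    · rw [hoff j hj, Function.update_of_ne hj]
  have hsw := hc.exists_swap hW h hu hw'
  have hnot := ih.swap_notMem hc hn hV hW h hu hw'
  have hcov : ∀ p : Pt c d, ∀ B, InBox u p → Hit V (Function.update p i B) := by
    intro p B hp
    rw [h]
    by_cases hB : u i ∈ (B : Set S)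
    · exact ⟨u, hu, inBox_update_pt.2 ⟨hB, fun n _ => hp n⟩⟩
    · exact ⟨_, hw', inBox_update_pt.2
        ⟨by simpa using compl_mem B hB, fun n hn => by simpa [hn] using hp n⟩⟩
  have hflip : ∀ p : Pt c d, InBox u p → ∀ f, (HitAt V i f p ↔ HitAt V i (c f) p) :=
    fun p hp => hc.hitAt_compl_of_cover_off hV.code fun B => hcov p B hp
  have htr := fun s => hV.sec_trace_card hc (v := u) (i := i) (s := s) fun p hp => hflip p hp s
  obtain ⟨p, hp, -⟩ := hc.exists_common₂ (hc.compat_self u)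
  obtain ⟨v, hv, hvp⟩ := hcov p (p i) hp
  rw [inBox_update_pt] at hvp
  have hs := sec_pos hv hp hvp.2
  generalize v i = s at hs
  obtain ⟨q, hqs, hqs', hq⟩ : ∃ q, q ≠ s ∧ q ≠ c s ∧ 0 < (sec c V u i q).card := by
    by_contra! hcon
    have hall : ∀ p : Pt c d, InBox u p → HitAt V i s p := by
      intro p hp
      obtain ⟨B, hB⟩ := hc.exists_mem_letter s
      obtain ⟨v, hv, hvp⟩ := hcov p B hp
      rw [inBox_update_pt] at hvp
      refine ⟨v, hv, ?_, hvp.2⟩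
      by_contra h1
      have h2 := hcon _ h1 fun h2 => compl_notMem B hB (h2 ▸ hvp.1)
      have h3 := sec_pos hv hp hvp.2
      omega
    have h1 := (hc.cover_five (hV.twinFree_sec hc u i s) fun p hp =>
      (hit_sec hp).2 (hall p hp)).resolve_left fun h1 => hnot s (mem_sec.1 h1).2.1
    have h2 := (hc.cover_five (hV.twinFree_sec hc u i (c s)) fun p hp =>
      (hit_sec hp).2 ((hflip p hp s).1 (hall p hp))).resolve_left
        fun h1 => hnot _ (mem_sec.1 h1).2.1
    have h3 := sum_sec_le (c := c) V u i [s, c s] (by simpa using (hc.ne s).symm)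
    simp only [List.map_cons, List.map_nil, List.sum_cons, List.sum_nil] at h3
    omega
  have hcq : c q ≠ c s := fun h => hqs (hc.inj h)
  have hcq' : c q ≠ s := fun h => hqs' (by rw [← h, hc.invol])
  have hsum := sum_sec_le (c := c) V u i [s, c s, q, c q] (by
    simp [(hc.ne s).symm, (hc.ne q).symm, hqs.symm, hqs'.symm, hcq.symm, hcq'.symm])
  simp only [List.map_cons, List.map_nil, List.sum_cons, List.sum_nil] at hsum
  have h1 := htr s
  have h2 := htr q
  have key := fun (s q : S) => ih.two_pairs hc hn h9 hV hsw hflip (s := s) (q := q)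
  have key' := fun s q => key s (c q)
  simp only [hc.invol] at key'
  by_cases hss : (sec c V u i s).card = 2 ∧ (sec c V u i (c s)).card = 2
  · by_cases hq2 : (sec c V u i q).card = 2
    · exact key s q hqs hqs' hss.1 hss.2 hq2 (by omega)
    · exact key' s q hcq' hcq hss.1 hss.2 (by omega) (by omega)
  · by_cases hs2 : (sec c V u i s).card = 2
    · exact key q s hqs.symm (fun h => hcq' h.symm) (by omega) (by omega) hs2 (by omega)
    · exact key' q s hqs'.symm hcq.symm (by omega) (by omega) (by omega) (by omega)

end TwinsInW

section Shadows

variable {c : S → S} {d : ℕ}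

/-- Two words `v₁`, `v₂` of `V` which become a twin pair when position `i` is ignored, together
with an equivalent disjoint code `W` having few words with letter in `B` at position `i`. -/
structure TwinShadow (c : S → S) (V W : Finset (Fin d → S)) (i j : Fin d) (B : ESet c)
    (v₁ v₂ : Fin d → S) : Prop where
  twinFree : TwinFreeCode c V
  twinFree' : TwinFreeCode c W
  region : SameRegion c V W
  card_le : V.card ≤ 9
  card_le' : W.card ≤ 9
  disjoint : ∀ w, w ∈ V → w ∈ W → False
  sum_le : ∀ l : List S, l.Nodup → (∀ s ∈ l, s ∈ (B : Set S)) →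
    (l.map fun s => (slice W i s).card).sum ≤ 4
  mem₁ : v₁ ∈ V
  mem₂ : v₂ ∈ V
  letter₁ : v₁ i ∈ (B : Set S)
  letter₂ : v₂ i ∈ (B : Set S)
  ne : v₂ i ≠ v₁ i
  hji : j ≠ i
  compl : v₂ j = c (v₁ j)
  eq_off : ∀ n, n ≠ i → n ≠ j → v₂ n = v₁ n
  pos₁ : 0 < (slice W i (v₁ i)).card
  pos₁' : 0 < (slice W i (c (v₁ i))).card
  pos₂ : 0 < (slice W i (v₂ i)).card
  pos₂' : 0 < (slice W i (c (v₂ i))).card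

variable {V W : Finset (Fin d → S)} {i j : Fin d} {B : ESet c} {v₁ v₂ : Fin d → S}

theorem TwinShadow.symm (hc : IsComplementation c) (h : TwinShadow c V W i j B v₁ v₂) :
    TwinShadow c V W i j B v₂ v₁ :=
  { h with
    mem₁ := h.mem₂
    mem₂ := h.mem₁
    letter₁ := h.letter₂
    letter₂ := h.letter₁
    ne := h.ne.symm
    compl := hc.eq_comm h.compl
    eq_off := fun n h1 h2 => (h.eq_off n h1 h2).symm
    pos₁ := h.pos₂
    pos₁' := h.pos₂'
    pos₂ := h.pos₁
    pos₂' := h.pos₁' }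

theorem ne_of_mem {B : ESet c} {s t : S} (hs : s ∈ (B : Set S)) (ht : t ∈ (B : Set S)) :
    t ≠ c s := fun h => compl_notMem B hs (h ▸ ht)

theorem TwinShadow.flip [Finite S] (hc : IsComplementation c)
    (h : TwinShadow c V W i j B v₁ v₂) {q : S} (h1 : q ≠ v₁ i) (h2 : q ≠ c (v₁ i)) {p : Pt c d}
    (hp : InBox v₁ p) : HitAt W i q p ↔ HitAt W i (c q) p :=
  hc.hitAt_compl_of_cover h.twinFree'.code (fun p hp => (h.region p).1 ⟨v₁, h.mem₁, hp⟩) h1 h2 hp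

theorem TwinShadow.sec_card [Finite S] (hc : IsComplementation c)
    (h : TwinShadow c V W i j B v₁ v₂) {q : S} (h1 : q ≠ v₁ i) (h2 : q ≠ c (v₁ i)) :
    ((sec c W v₁ i q).card = 0 ∧ (sec c W v₁ i (c q)).card = 0) ∨
      (2 ≤ (sec c W v₁ i q).card ∧ 2 ≤ (sec c W v₁ i (c q)).card) ∨
      ((sec c W v₁ i q).card = 1 ∧ 5 ≤ (sec c W v₁ i (c q)).card) ∨
      ((sec c W v₁ i (c q)).card = 1 ∧ 5 ≤ (sec c W v₁ i q).card) :=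
  h.twinFree'.sec_trace_card hc (v := v₁) (i := i) (s := q) fun _ hp => h.flip hc h1 h2 hp

theorem TwinShadow.exists_hit (h : TwinShadow c V W i j B v₁ v₂) {p : Pt c d} (hp : InBox v₁ p) :
    ∃ w ∈ W, w i ∈ (B : Set S) ∧ ∀ n, n ≠ i → w n ∈ (p n : Set S) := by
  obtain ⟨w, hw, hwp⟩ := (h.region (Function.update p i B)).1
    ⟨v₁, h.mem₁, inBox_update_pt.2 ⟨h.letter₁, fun n _ => hp n⟩⟩
  exact ⟨w, hw, inBox_update_pt.1 hwp⟩

theorem pair_nodup (hc : IsComplementation c) {s t : S} (h1 : t ≠ s) (h2 : t ≠ c s) :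
    [s, c s, t, c t].Nodup := by
  have h3 : c t ≠ c s := fun h => h1 (hc.inj h)
  have h4 : c t ≠ s := fun h => h2 (by rw [← h, hc.invol])
  simp [(hc.ne s).symm, (hc.ne t).symm, h1.symm, h2.symm, h3.symm, h4.symm]

theorem pairs_nodup (hc : IsComplementation c) {s t q : S} (h1 : t ≠ s) (h2 : t ≠ c s)
    (h3 : q ≠ s) (h4 : q ≠ c s) (h5 : q ≠ t) (h6 : q ≠ c t) :
    [q, c q, s, c s, t, c t].Nodup := by
  have h3' : c q ≠ c s := fun h => h3 (hc.inj h)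
  have h4' : c q ≠ s := fun h => h4 (by rw [← h, hc.invol])
  have h5' : c q ≠ c t := fun h => h5 (hc.inj h)
  have h6' : c q ≠ t := fun h => h6 (by rw [← h, hc.invol])
  refine List.nodup_cons.2 ⟨?_, List.nodup_cons.2 ⟨?_, pair_nodup hc h1 h2⟩⟩
  · simp [(hc.ne q).symm, h3, h4, h5, h6]
  · simp [h3', h4', h5', h6']

theorem pos_of_sec_pos {K : Finset (Fin d → S)} {u : Fin d → S} {i : Fin d} {s : S}
    (h : 0 < (sec c K u i s).card) :
    ∃ w ∈ K, w i = s ∧ ¬ Dicho c u (Function.update w i (u i)) := by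
  obtain ⟨w, hw⟩ := Finset.card_pos.1 h
  have hw := mem_sec.1 hw
  refine ⟨_, hw.2.1, by simp, ?_⟩
  rw [Function.update_idem, ← hw.1, Function.update_eq_self]
  exact hw.2.2

/-- A word of `W` differing from `v₁` only at `j` by a letter outside the pair of `v₁ j` forces
too many words in `V`. -/
theorem TwinShadow.false_of_mem [Finite S] (hc : IsComplementation c)
    (h : TwinShadow c V W i j B v₁ v₂) {w : Fin d → S} (hw : w ∈ W) (hwi : w i = v₁ i)
    (hwn : ∀ n, n ≠ i → n ≠ j → w n = v₁ n) (hwj : w j ≠ v₁ j)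
    (hpos : 0 < (sec c W v₁ i (v₂ i)).card) : False := by
  have hts : v₂ i ≠ c (v₁ i) := ne_of_mem h.letter₁ h.letter₂
  have hsec : ∀ x ∈ sec c V w i (v₂ i), x = Function.update v₂ i (w i) := by
    intro x hx
    have hx := mem_sec.1 hx
    have hcomp : ∀ n, n ≠ i → n ≠ j → x n ≠ c (v₁ n) := fun n h1 h2 h3 =>
      hx.2.2 ⟨n, by rw [hwn n h1 h2, h3]⟩
    have h1 : Function.update x i (v₂ i) = v₂ := by
      by_contra hne
      obtain ⟨n, hn, hn'⟩ := exists_dicho_off h.twinFree.code h.mem₂ hx.2.1 (Ne.symm hne) (i := i)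
        (by simpa using (hc.ne _).symm)
      obtain ⟨m, hm, hm'⟩ := exists_dicho_off (i := i) h.twinFree.code h.mem₁ hx.2.1
        (fun h' => h.ne (by simpa using (congrFun h' i).symm)) (by simpa using hts)
      rw [Function.update_of_ne hn] at hn'
      rw [Function.update_of_ne hm] at hm'
      by_cases hnj : n = j
      · by_cases hmj : m = j
        · rw [hnj, h.compl, hc.invol] at hn'
          rw [hmj, hn'] at hm'
          exact hc.ne _ hm'.symm
        · exact hcomp m hm hmj hm'
      · rw [h.eq_off n hn hnj] at hn'
        exact hcomp n hn hnj hn'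
    rw [← h1, Function.update_idem, ← hx.1, Function.update_eq_self]
  have hv₂ : Function.update v₂ i (w i) ∈ sec c V w i (v₂ i) := update_mem_sec h.mem₂ rfl (by
    rintro ⟨n, hn⟩
    by_cases hni : n = i
    · rw [hni, Function.update_self] at hn
      exact hc.ne _ hn.symm
    · rw [Function.update_of_ne hni] at hn
      by_cases hnj : n = j
      · rw [hnj, h.compl] at hn
        exact hwj (hc.inj hn).symm
      · rw [h.eq_off n hni hnj, hwn n hni hnj] at hn
        exact hc.ne _ hn.symm)
  have hcard : (sec c V w i (v₂ i)).card = 1 :=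
    Finset.card_eq_one.2 ⟨_, Finset.eq_singleton_iff_unique_mem.2 ⟨hv₂, hsec⟩⟩
  have h1 := h.twinFree.sec_trace_card hc (v := w) (i := i) (s := v₂ i) fun p hp =>
    hc.hitAt_compl_of_cover h.twinFree.code (fun p hp => (h.region p).2 ⟨w, hw, hp⟩)
      (by rw [hwi]; exact h.ne) (by rwa [hwi]) hp
  obtain ⟨z, hz, hzi, hzv⟩ := pos_of_sec_pos hpos
  have h2 := h.twinFree.sec_trace_card hc (v := z) (i := i) (s := v₁ i) fun p hp =>
    hc.hitAt_compl_of_cover h.twinFree.code (fun p hp => (h.region p).2 ⟨z, hz, hp⟩)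
      (by rw [hzi]; exact h.ne.symm) (by rw [hzi]; exact hc.ne_comm hts) hp
  have h3 : 0 < (sec c V z i (v₁ i)).card :=
    Finset.card_pos.2 ⟨_, update_mem_sec h.mem₁ rfl (by
      rintro ⟨n, hn⟩
      by_cases hni : n = i
      · rw [hni, Function.update_self] at hn
        exact hc.ne _ hn.symm
      · rw [Function.update_of_ne hni] at hn
        exact hzv ⟨n, by rw [Function.update_of_ne hni]; exact hc.eq_comm hn⟩)⟩
  have h4 := sum_slice_le V i _ (pair_nodup hc h.ne hts)
  simp only [List.map_cons, List.map_nil, List.sum_cons, List.sum_nil] at h4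
  have h5 := sec_card_le c V w i (v₂ i)
  have h6 := sec_card_le c V w i (c (v₂ i))
  have h7 := sec_card_le c V z i (v₁ i)
  have h8 := sec_card_le c V z i (c (v₁ i))
  have h9 := h.card_le
  omega

theorem TwinShadow.false_of_two [Finite S] (hc : IsComplementation c)
    (h : TwinShadow c V W i j B v₁ v₂) (h₁ : (slice W i (v₁ i)).card = 2)
    (h₂ : (slice W i (v₂ i)).card = 2) (h₂' : (slice W i (c (v₂ i))).card = 2)
    (hs₁ : (sec c W v₁ i (v₂ i)).card = 2) (hs₁' : (sec c W v₁ i (c (v₂ i))).card = 2)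
    (hs₂ : (sec c W v₂ i (v₁ i)).card = 2) : False := by
  have hts : v₂ i ≠ c (v₁ i) := ne_of_mem h.letter₁ h.letter₂
  have hWB : ∀ w ∈ W, w i ∈ (B : Set S) → w i = v₁ i ∨ w i = v₂ i := by
    intro w hw hwB
    by_contra! hcon
    have h3 := h.sum_le [w i, v₁ i, v₂ i] (by simp [hcon.1, hcon.2, h.ne.symm])
      (by simp [hwB, h.letter₁, h.letter₂])
    have h4 : 0 < (slice W i (w i)).card := Finset.card_pos.2 ⟨w, mem_slice.2 ⟨hw, rfl⟩⟩
    simp only [List.map_cons, List.map_nil, List.sum_cons, List.sum_nil] at h3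
    omega
  have hWs : ∀ w ∈ W, w i = v₁ i → ∀ n, n ≠ i → w n ≠ c (v₂ n) := fun w hw hwi n hn h' =>
    compat_of_slice_card_le (c := c) (u := v₂) (h₁.trans hs₂.symm).le hw hwi
      ⟨n, by rwa [Function.update_of_ne hn]⟩
  have hWt : ∀ w ∈ W, w i = v₂ i → Function.update w i (v₁ i) ∈ sec c W v₁ i (v₂ i) :=
    fun w hw hwi => update_mem_sec hw hwi
      (compat_of_slice_card_le (h₂.trans hs₁.symm).le hw hwi)
  obtain ⟨x, k, l, hsp⟩ := hc.exists_splitPair (h.twinFree'.twinFree_sec hc v₁ i (v₂ i))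
    (h.twinFree'.twinFree_sec hc v₁ i (c (v₂ i))) hs₁ hs₁' (fun _ h => sec_compat h)
    (fun _ h => sec_compat h) (fun _ h1 h2 => h.twinFree'.sec_disjoint h1 h2)
    fun p hp => (hit_sec hp).trans ((h.flip hc h.ne hts hp).trans (hit_sec hp).symm)
  have hxA := (hsp.mem x).2 (Or.inl rfl)
  have hyA := (hsp.mem _).2 (Or.inr rfl)
  have hrA := (hsp.mem' _).2 (Or.inr rfl)
  have hxi := (mem_sec.1 hxA).1
  have hxc : ∀ n, x n ≠ c (v₁ n) := fun n h' => sec_compat hxA ⟨n, h'⟩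
  have hki : k ≠ i := by
    rintro rfl
    exact hsp.ne_k hxi
  have hli : l ≠ i := by
    rintro rfl
    exact hsp.ne_l hxi
  have hor : ∀ p : Pt c d, InBox v₁ p → (HitAt W i (v₁ i) p ↔ ¬ HitAt W i (v₂ i) p) := by
    intro p hp
    refine ⟨fun h1 h2 => hc.not_hitAt_hitAt h.twinFree'.code h.ne hts h1 h2, fun h1 => ?_⟩
    obtain ⟨w, hw, hwB, hwp⟩ := h.exists_hit hp
    rcases hWB w hw hwB with h2 | h2
    · exact ⟨w, hw, h2, hwp⟩
    · exact absurd ⟨w, hw, h2, hwp⟩ h1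
  have hQ2 : (sec c W v₁ i (v₁ i)).card ≤ 2 := h₁ ▸ sec_card_le c W v₁ i (v₁ i)
  by_cases htriv : ∀ n, n ≠ k → n ≠ l → x n = v₁ n
  · have hω := hsp.mem_of_trivial hc (fun _ h => sec_compat h) htriv
      (h.twinFree'.twinFree_sec hc v₁ i (v₁ i)) (by omega) (fun _ h => sec_compat h) fun p hp => by
        rw [hit_sec hp, hit_sec hp]
        exact hor p hp
    have hωW := (mem_sec.1 hω).2.1
    set ω := Function.update (Function.update (Function.update v₁ k (x k)) l (c (x l))) i (v₁ i)
      with hω'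
    have hωi : ω i = v₁ i := by simp [hω']
    have hωk : ω k = x k := by simp [hω', hki, hsp.ne]
    have hωl : ω l = c (x l) := by simp [hω', hli]
    have hωn : ∀ n, n ≠ k → n ≠ l → ω n = v₁ n := fun n h1 h2 => by
      by_cases hni : n = i
      · rw [hni, hωi]
      · simp [hω', hni, h1, h2]
    by_cases hkj : k = j
    · subst hkj
      refine (h.symm hc).false_of_mem hc (mem_sec.1 hyA).2.1 (by simp) (fun n h1 h2 => ?_) ?_
        (by omega)
      · rw [Function.update_of_ne h1, h.eq_off n h1 h2]
        by_cases hnl : n = l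
        · rw [hnl, Function.update_self]
        · simp [hnl, h2, htriv n h2 hnl]
      · simp only [Function.update_of_ne hki, Function.update_of_ne hsp.ne, Function.update_self,
          h.compl]
        exact fun h' => hsp.ne_k (hc.inj h')
    · have hlj : l = j := by
        by_contra hlj
        refine hWs ω hωW hωi j h.hji ?_
        rw [hωn j (Ne.symm hkj) (Ne.symm hlj), h.compl, hc.invol]
      subst hlj
      have hv₂k := h.eq_off k hki hsp.ne
      obtain ⟨Bk, hBk, hBk'⟩ := hc.exists_mem_letters (a := c (x k)) (b := v₁ k)
        (by rw [hc.invol]; exact hsp.ne_k.symm)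
      obtain ⟨Bl, hBl, hBl'⟩ := hc.exists_mem_letters (a := c (x l)) (b := c (v₁ l))
        (fun h' => hxc l (by rw [h', hc.invol]))
      obtain ⟨p, hp, -⟩ := hc.exists_common₂ (hc.compat_self v₁)
      have hp2 : InBox v₂
          (Function.update (Function.update (Function.update p k Bk) l Bl) i B) := by
        refine inBox_update_pt.2 ⟨h.letter₂, fun n hn => ?_⟩
        by_cases hnl : n = l
        · rw [hnl, Function.update_self, h.compl]
          exact hBl'
        · rw [Function.update_of_ne hnl, h.eq_off n hn hnl]
          by_cases hnk : n = k
          · rw [hnk, Function.update_self]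
            exact hBk'
          · rw [Function.update_of_ne hnk]
            exact hp n
      obtain ⟨y, hy, hyp⟩ := (h.region _).1 ⟨v₂, h.mem₂, hp2⟩
      have hyi := hyp i
      have hyk := hyp k
      have hyl := hyp l
      simp only [Function.update_self, Function.update_of_ne hki, Function.update_of_ne hli,
        Function.update_of_ne hsp.ne] at hyi hyk hyl
      have hxk : x k ∉ (Bk : Set S) := notMem_of_compl Bk hBk
      have hxl : x l ∉ (Bl : Set S) := notMem_of_compl Bl hBl
      have hyn : ∀ n, n ≠ i → n ≠ k → n ≠ l → y n ≠ c (v₁ n) := fun n h1 h2 h3 h4 => by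
        have h5 := hyp n
        rw [Function.update_of_ne h1, Function.update_of_ne h3, Function.update_of_ne h2, h4] at h5
        exact compl_notMem _ (hp n) h5
      rcases hWB y hy hyi with h1 | h1
      · have hyω : y ≠ ω := fun h' => hxk (by rw [← hωk, ← h']; exact hyk)
        obtain ⟨n, hn, hn'⟩ := exists_dicho_off (i := i) h.twinFree'.code hωW hy hyω.symm
          (by rw [hωi, h1]; exact (hc.ne _).symm)
        obtain ⟨m, hm, hm'⟩ := exists_dicho_off (i := i) h.twinFree'.code (mem_sec.1 hrA).2.1 hy
          (fun h' => hts (hc.eq_comm (by rw [← h1, ← h', Function.update_self])))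
          (by rw [Function.update_self, hc.invol, h1]; exact h.ne.symm)
        rw [Function.update_of_ne hm] at hm'
        have h3 : y k = c (x k) := by
          by_cases hnl : n = l
          · rw [hnl, hωl, hc.invol] at hn'
            exact absurd (hn' ▸ hyl) hxl
          · by_cases hnk : n = k
            · rwa [hnk, hωk] at hn'
            · rw [hωn n hnk hnl] at hn'
              exact absurd hn' (hyn n hn hnk hnl)
        by_cases hml : m = l
        · rw [hml, Function.update_self, hc.invol] at hm'
          exact hxl (hm' ▸ hyl)
        · rw [Function.update_of_ne hml] at hm'
          by_cases hmk : m = k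
          · rw [hmk, Function.update_self, h3] at hm'
            exact hc.ne _ hm'.symm
          · rw [Function.update_of_ne hmk, htriv m hmk hml] at hm'
            exact hyn m hm hmk hml hm'
      · rcases (hsp.mem _).1 (hWt y hy h1) with h2 | h2
        · have := congrFun h2 k
          rw [Function.update_of_ne hki] at this
          exact hxk (this ▸ hyk)
        · have := congrFun h2 l
          rw [Function.update_of_ne hli, Function.update_self] at this
          rw [this] at hyl
          exact notMem_of_compl Bl hBl' hyl
  · push Not at htriv
    obtain ⟨m, hmk, hml, hxm⟩ := htriv
    have hmi : m ≠ i := by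
      rintro rfl
      exact hxm hxi
    have hω := hsp.mem_of_nontrivial hc (h.twinFree'.twinFree_sec hc v₁ i (v₂ i)) hs₁
      (fun _ h => sec_compat h) hmk hml hxm (h.twinFree'.twinFree_sec hc v₁ i (v₁ i)) hQ2
      (fun _ h => sec_compat h) (fun a ha b hb => by
        have ha := mem_sec.1 ha
        have hb := mem_sec.1 hb
        obtain ⟨n, hn, hn'⟩ := exists_dicho_off h.twinFree'.code ha.2.1 hb.2.1 (i := i)
          (fun h' => h.ne (by simpa using congrFun h' i))
          (by simpa using hc.ne_comm hts)
        exact ⟨n, by simpa [hn] using hn'⟩) fun p hp => by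
        rw [hit_sec hp, hit_sec hp, hor p hp]
        exact Classical.em _
    have hωW := (mem_sec.1 hω).2.1
    by_cases hmj : m = j
    · subst hmj
      refine h.false_of_mem hc hωW (by simp) (fun n h1 h2 => by simp [h1, h2]) ?_ (by omega)
      · rw [Function.update_of_ne hmi, Function.update_self]
        exact fun h' => hxc m (hc.eq_comm h'.symm)
    · refine hWs _ hωW (by simp) j h.hji ?_
      rw [Function.update_of_ne h.hji, Function.update_of_ne (Ne.symm hmj), h.compl, hc.invol]

theorem TwinShadow.exists_letter [Finite S] (hc : IsComplementation c)
    (h : TwinShadow c V W i j B v₁ v₂) (h0 : (sec c W v₁ i (v₂ i)).card = 0) :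
    ∃ q ∈ (B : Set S), q ≠ v₁ i ∧ q ≠ v₂ i ∧ 0 < (sec c W v₁ i q).card := by
  by_contra! hcon
  refine h.disjoint v₁ h.mem₁ ?_
  obtain h1 | h1 := hc.cover_five (h.twinFree'.twinFree_sec hc v₁ i (v₁ i)) (v := v₁)
    fun p hp => by
      obtain ⟨w, hw, hwB, hwp⟩ := h.exists_hit hp
      have h1 := sec_pos hw hp hwp
      refine (hit_sec hp).2 ⟨w, hw, ?_, hwp⟩
      by_contra h2
      have h3 : w i ≠ v₂ i := fun h3 => by
        rw [h3] at h1
        omega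
      have := hcon _ hwB h2 h3
      omega
  · simpa using (mem_sec.1 h1).2.1
  · have h2 := sec_card_le c W v₁ i (v₁ i)
    have h3 := h.sum_le [v₁ i] (by simp) (by simp [h.letter₁])
    simp only [List.map_cons, List.map_nil, List.sum_cons, List.sum_nil] at h3
    omega

theorem TwinShadow.false_of_sec_eq_zero [Finite S] (hc : IsComplementation c)
    (h : TwinShadow c V W i j B v₁ v₂) (h0 : (sec c W v₁ i (v₂ i)).card = 0) : False := by
  classical
  have hts : v₂ i ≠ c (v₁ i) := ne_of_mem h.letter₁ h.letter₂
  have hp₁ := h.pos₁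
  have hp₁' := h.pos₁'
  have hp₂ := h.pos₂
  have hp₂' := h.pos₂'
  have h9 := h.card_le'
  obtain ⟨q, hqB, hqs, hqt, hq⟩ := h.exists_letter hc h0
  have hqs' := ne_of_mem h.letter₁ hqB
  have hqt' := ne_of_mem h.letter₂ hqB
  have hsum := sum_slice_le W i _ (pairs_nodup hc h.ne hts hqs hqs' hqt hqt')
  simp only [List.map_cons, List.map_nil, List.sum_cons, List.sum_nil] at hsum
  have htr := h.sec_card hc hqs hqs'
  have e1 := sec_card_le c W v₁ i q
  have e2 := sec_card_le c W v₁ i (c q)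
  have h0' : (sec c W v₂ i (v₁ i)).card = 0 := by
    have h1 := (h.symm hc).sec_card hc h.ne.symm (hc.ne_comm hts)
    have e3 := sec_card_le c W v₂ i (v₁ i)
    have e4 := sec_card_le c W v₂ i (c (v₁ i))
    omega
  obtain ⟨r, hrB, hrt, hrs, hr⟩ := (h.symm hc).exists_letter hc h0'
  have hrt' := ne_of_mem h.letter₂ hrB
  have hrs' := ne_of_mem h.letter₁ hrB
  have htr2 := (h.symm hc).sec_card hc hrt hrt'
  have e3 := sec_card_le c W v₂ i r
  have e4 := sec_card_le c W v₂ i (c r)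
  have hrq : r = q := by
    by_contra hrq
    have hsum2 := sum_slice_le W i _
      (pairs_nodup hc hrq (ne_of_mem hqB hrB) hqs.symm (ne_of_mem hqB h.letter₁) hrs.symm
        (ne_of_mem hrB h.letter₁))
    simp only [List.map_cons, List.map_nil, List.sum_cons, List.sum_nil] at hsum2
    omega
  subst hrq
  have hsumB := h.sum_le [v₁ i, v₂ i, r] (by simp [h.ne.symm, hqs.symm, hqt.symm])
    (by simp [h.letter₁, h.letter₂, hqB])
  simp only [List.map_cons, List.map_nil, List.sum_cons, List.sum_nil] at hsumB
  have hWB : ∀ w ∈ W, w i ∈ (B : Set S) → w i = v₁ i ∨ w i = v₂ i ∨ w i = r := by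
    intro w hw hwB
    by_contra! hcon
    have h3 := h.sum_le [w i, v₁ i, v₂ i, r]
      (by simp [hcon.1, hcon.2.1, hcon.2.2, h.ne.symm, hqs.symm, hqt.symm])
      (by simp [hwB, h.letter₁, h.letter₂, hqB])
    have h4 : 0 < (slice W i (w i)).card := Finset.card_pos.2 ⟨w, mem_slice.2 ⟨hw, rfl⟩⟩
    simp only [List.map_cons, List.map_nil, List.sum_cons, List.sum_nil] at h3
    omega
  set Q := sec c W v₁ i r with hQ
  have hQj : ∀ z ∈ Q, z j ≠ v₁ j ∧ z j ≠ c (v₁ j) := by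
    intro z hz
    have hz := mem_sec.1 hz
    refine ⟨fun h1 => ?_, fun h1 => hz.2.2 ⟨j, h1⟩⟩
    refine compat_of_slice_card_le (K := W) (i := i) (c := c) (u := v₂) (s := r) (by omega)
      hz.2.1 (by simp) ⟨j, ?_⟩
    simp only [Function.update_of_ne h.hji]
    rw [h1, h.compl, hc.invol]
  have hQt : TwinFreeCode c Q := h.twinFree'.twinFree_sec hc v₁ i r
  have hcov : ∀ p : Pt c d, InBox v₁ p → Hit (sec c W v₁ i (v₁ i)) p ∨ Hit Q p := by
    intro p hp
    obtain ⟨w, hw, hwB, hwp⟩ := h.exists_hit hp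
    have h1 := sec_pos hw hp hwp
    rw [hit_sec hp, hit_sec hp]
    rcases hWB w hw hwB with h2 | h2 | h2
    · exact Or.inl ⟨w, hw, h2, hwp⟩
    · rw [h2] at h1
      omega
    · exact Or.inr ⟨w, hw, h2, hwp⟩
  have hyj : ∀ y ∈ sec c W v₁ i (v₁ i), y j = v₁ j := by
    intro y hy
    have hy := mem_sec.1 hy
    by_contra hne
    have h1 : Function.update y i (v₂ i) ∈ sec c W v₂ i (v₁ i) := by
      have := update_mem_sec (c := c) (u := v₂) (i := i) (s := v₁ i) hy.2.1 (by simp)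
        (by
          rintro ⟨n, hn⟩
          by_cases hni : n = i
          · rw [hni, Function.update_self] at hn
            exact hc.ne _ hn.symm
          · rw [Function.update_of_ne hni, Function.update_of_ne hni] at hn
            by_cases hnj : n = j
            · rw [hnj, h.compl, hc.invol] at hn
              exact hne hn
            · rw [h.eq_off n hni hnj] at hn
              exact hy.2.2 ⟨n, hn⟩)
      rwa [Function.update_idem] at this
    rw [Finset.card_eq_zero.1 h0'] at h1
    simp at h1
  have hK : PolyboxCode c ((sec c W v₁ i (v₁ i) ∪ Q : Finset (Fin d → S)) : Set (Fin d → S)) := by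
    have key : ∀ a ∈ sec c W v₁ i (v₁ i), ∀ b ∈ Q, Dicho c a b := fun a ha b hb => by
      have ha := mem_sec.1 ha
      have hb := mem_sec.1 hb
      obtain ⟨n, hn, hn'⟩ := exists_dicho_off h.twinFree'.code ha.2.1 hb.2.1 (i := i)
        (fun h' => hqs (by simpa using (congrFun h' i).symm)) (by simpa using hqs')
      exact ⟨n, by simpa [hn] using hn'⟩
    intro a ha b hb hab
    rw [Finset.mem_coe, Finset.mem_union] at ha hb
    rcases ha with ha | ha <;> rcases hb with hb | hb
    · exact (h.twinFree'.twinFree_sec hc v₁ i (v₁ i)).code a ha b hb hab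
    · exact key a ha b hb
    · exact hc.dicho_symm (key b hb a ha)
    · exact hQt.code a ha b hb hab
  have hKQ : ∀ f, f ≠ v₁ j → ∀ p : Pt c d,
      HitAt (sec c W v₁ i (v₁ i) ∪ Q) j f p ↔ HitAt Q j f p := by
    intro f hf p
    constructor
    · rintro ⟨w, hw, h1, h2⟩
      rcases Finset.mem_union.1 hw with hw | hw
      · exact absurd (h1.symm.trans (hyj w hw)) hf
      · exact ⟨w, hw, h1, h2⟩
    · rintro ⟨w, hw, h1, h2⟩
      exact ⟨w, Finset.mem_union_right _ hw, h1, h2⟩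
  obtain ⟨z, hz⟩ := Finset.card_pos.1 hq
  obtain ⟨hz1, hz2⟩ := hQj z hz
  have h1 := hQt.sec_trace_card hc (v := v₁) (i := j) (s := z j) fun p hp => by
    rw [← hKQ _ hz1, ← hKQ _ fun h' => hz2 (by rw [← h', hc.invol])]
    exact hc.hitAt_compl_of_cover hK (fun p hp => by
      rcases hcov p hp with ⟨a, ha, hap⟩ | ⟨a, ha, hap⟩
      exacts [⟨a, Finset.mem_union_left _ ha, hap⟩, ⟨a, Finset.mem_union_right _ ha, hap⟩])
      hz1 hz2 hp
  have h2 : 0 < (sec c Q v₁ j (z j)).card := Finset.card_pos.2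
    ⟨_, update_mem_sec hz rfl (compat_update (sec_compat hz) (hc.ne _).symm)⟩
  have h3 := sum_sec_le (c := c) Q v₁ j [z j, c (z j)] (by simpa using (hc.ne _).symm)
  simp only [List.map_cons, List.map_nil, List.sum_cons, List.sum_nil] at h3
  omega

theorem TwinShadow.false [Finite S] (hc : IsComplementation c)
    (h : TwinShadow c V W i j B v₁ v₂) : False := by
  by_cases h1 : (sec c W v₁ i (v₂ i)).card = 0
  · exact h.false_of_sec_eq_zero hc h1
  by_cases h2 : (sec c W v₂ i (v₁ i)).card = 0
  · exact (h.symm hc).false_of_sec_eq_zero hc h2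
  have hts : v₂ i ≠ c (v₁ i) := ne_of_mem h.letter₁ h.letter₂
  have t1 := h.sec_card hc h.ne hts
  have t2 := (h.symm hc).sec_card hc h.ne.symm (hc.ne_comm hts)
  have hsum := sum_slice_le W i _ (pair_nodup hc h.ne hts)
  have hsumB := h.sum_le [v₁ i, v₂ i] (by simp [h.ne.symm]) (by simp [h.letter₁, h.letter₂])
  simp only [List.map_cons, List.map_nil, List.sum_cons, List.sum_nil] at hsum hsumB
  have h9 := h.card_le'
  have e1 := sec_card_le c W v₁ i (v₂ i)
  have e2 := sec_card_le c W v₁ i (c (v₂ i))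
  have e3 := sec_card_le c W v₂ i (v₁ i)
  have e4 := sec_card_le c W v₂ i (c (v₁ i))
  by_cases h3 : (slice W i (c (v₂ i))).card = 2
  · exact h.false_of_two hc (by omega) (by omega) h3 (by omega) (by omega) (by omega)
  · exact (h.symm hc).false_of_two hc (by omega) (by omega) (by omega) (by omega) (by omega)
      (by omega)

end Shadows

section Rigidity

variable {c : S → S} {d : ℕ}

theorem hit_slice {K : Finset (Fin d → S)} {i : Fin d} {s : S} {p : Pt c d} :
    Hit (slice K i s) p ↔ s ∈ (p i : Set S) ∧ HitAt K i s p := by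
  constructor
  · rintro ⟨w, hw, hwp⟩
    have hw := mem_slice.1 hw
    exact ⟨hw.2 ▸ hwp i, w, hw.1, hw.2, fun n _ => hwp n⟩
  · rintro ⟨hs, w, hw, hwi, hwp⟩
    refine ⟨w, mem_slice.2 ⟨hw, hwi⟩, fun n => ?_⟩
    by_cases hn : n = i
    · rw [hn, hwi]
      exact hs
    · exact hwp n hn

theorem slice_subset (K : Finset (Fin d → S)) (i : Fin d) (s : S) : slice K i s ⊆ K :=
  fun _ hw => (mem_slice.1 hw).1

open Classical in
/-- The words of `K` with letter in `B` at position `i`, that letter being replaced by `g`. -/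
noncomputable def shadow (K : Finset (Fin d → S)) (i : Fin d) (B : ESet c) (g : S) :
    Finset (Fin d → S) :=
  (K.filter fun w => w i ∈ (B : Set S)).image fun w => Function.update w i g

variable {K V W : Finset (Fin d → S)} {i : Fin d} {B : ESet c} {g : S}

theorem mem_shadow {x : Fin d → S} :
    x ∈ shadow K i B g ↔ ∃ w ∈ K, w i ∈ (B : Set S) ∧ Function.update w i g = x := by
  simp [shadow, and_assoc]

theorem hit_shadow {p : Pt c d} :
    Hit (shadow K i B g) p ↔ g ∈ (p i : Set S) ∧ Hit K (Function.update p i B) := by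
  constructor
  · rintro ⟨x, hx, hxp⟩
    obtain ⟨w, hw, hwB, rfl⟩ := mem_shadow.1 hx
    rw [inBox_update] at hxp
    exact ⟨hxp.1, w, hw, inBox_update_pt.2 ⟨hwB, hxp.2⟩⟩
  · rintro ⟨hg, w, hw, hwp⟩
    rw [inBox_update_pt] at hwp
    exact ⟨_, mem_shadow.2 ⟨w, hw, hwp.1, rfl⟩, inBox_update.2 ⟨hg, hwp.2⟩⟩

theorem dicho_update (hK : PolyboxCode c (K : Set (Fin d → S))) {u v : Fin d → S} (hu : u ∈ K)
    (hv : v ∈ K) (huB : u i ∈ (B : Set S)) (hvB : v i ∈ (B : Set S)) (huv : u ≠ v) :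
    Dicho c (Function.update u i g) (Function.update v i g) := by
  obtain ⟨j, hj, hj'⟩ := exists_dicho_off hK hu hv huv (ne_of_mem huB hvB)
  exact ⟨j, by simpa [hj] using hj'⟩

theorem polyboxCode_shadow (hK : PolyboxCode c (K : Set (Fin d → S))) :
    PolyboxCode c (shadow K i B g : Set (Fin d → S)) := by
  intro x hx y hy hxy
  obtain ⟨u, hu, huB, rfl⟩ := mem_shadow.1 hx
  obtain ⟨v, hv, hvB, rfl⟩ := mem_shadow.1 hy
  exact dicho_update hK hu hv huB hvB fun h => hxy (by rw [h])

open Classical in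
theorem card_shadow (hc : IsComplementation c) (hK : PolyboxCode c (K : Set (Fin d → S))) :
    (shadow K i B g).card = (K.filter fun w => w i ∈ (B : Set S)).card := by
  refine Finset.card_image_of_injOn fun u hu v hv huv => ?_
  have hu := Finset.mem_filter.1 hu
  have hv := Finset.mem_filter.1 hv
  by_contra hne
  have h1 := dicho_update (g := u i) hK hu.1 hv.1 hu.2 hv.2 hne
  have h2 := congrArg (fun w => Function.update w i (u i)) huv
  simp only [Function.update_idem] at h2
  rw [h2] at h1
  exact hc.compat_self _ h1

theorem SameRegion.shadow (h : SameRegion c V W) :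
    SameRegion c (shadow V i B g) (shadow W i B g) := fun p => by
  rw [hit_shadow, hit_shadow, h]

theorem RigidBelow.false_of_letter_notMem [Finite S] (hc : IsComplementation c) {n : ℕ}
    (ih : RigidBelow c d n) (hn : V.card = n) (hV : TwinFreeCode c V)
    (hW : PolyboxCode c (W : Set (Fin d → S))) (h : SameRegion c V W) {v : Fin d → S}
    (hv : v ∈ V) (hWv : ∀ w ∈ W, w i ≠ v i) : False := by
  classical
  obtain ⟨B, hB⟩ := hc.exists_mem_letter (v i)
  have hhit : ∀ p : Pt c d, (HitAt V i (c (v i)) p ↔ HitAt V i (v i) p ∨ HitAt W i (c (v i)) p) ∧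
      ¬ (HitAt V i (v i) p ∧ HitAt W i (c (v i)) p) := fun p => by
    obtain ⟨P, Q, h1, h2, h3, h4, h5, h6⟩ := h.hitAt hc hV.code hW i (v i) p
    have h7 : ¬ HitAt W i (v i) p := fun ⟨w, hw, hwi, _⟩ => hWv w hw hwi
    tauto
  have hsh : ∀ p : Pt c d, Hit (_root_.shadow (slice V i (v i)) i B (c (v i))) p ↔
      c (v i) ∈ (p i : Set S) ∧ HitAt V i (v i) p := fun p => by
    rw [hit_shadow, hit_slice, Function.update_self]
    refine and_congr_right fun _ => ⟨fun ⟨_, w, hw, hwi, hwp⟩ => ⟨w, hw, hwi, fun n hn => ?_⟩,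
      fun ⟨w, hw, hwi, hwp⟩ => ⟨hB, w, hw, hwi, fun n hn => ?_⟩⟩
    · simpa [hn] using hwp n hn
    · simpa [hn] using hwp n hn
  have hcross : ∀ a ∈ _root_.shadow (slice V i (v i)) i B (c (v i)),
      ∀ b ∈ slice W i (c (v i)), Dicho c a b := fun a ha b hb => by
    by_contra hab
    obtain ⟨p, hpa, hpb⟩ := hc.exists_common₂ hab
    exact (hhit p).2 ⟨((hsh p).1 ⟨a, ha, hpa⟩).2, (hit_slice.1 ⟨b, hb, hpb⟩).2⟩
  have hsub : PolyboxCode c (slice V i (v i) : Set (Fin d → S)) :=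
    (hV.mono (slice_subset V i (v i))).code
  have h1 := ih (slice V i (c (v i)))
    (_root_.shadow (slice V i (v i)) i B (c (v i)) ∪ slice W i (c (v i)))
    (by
      rw [← hn]
      refine Finset.card_lt_card ⟨slice_subset _ _ _, fun h1 => ?_⟩
      exact hc.ne _ (mem_slice.1 (h1 hv)).2.symm)
    (hV.mono (slice_subset _ _ _))
    (by
      intro a ha b hb hab
      rw [Finset.mem_coe, Finset.mem_union] at ha hb
      rcases ha with ha | ha <;> rcases hb with hb | hb
      · exact polyboxCode_shadow hsub a ha b hb hab
      · exact hcross a ha b hb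
      · exact hc.dicho_symm (hcross b hb a ha)
      · exact hW a (slice_subset _ _ _ ha) b (slice_subset _ _ _ hb) hab)
    fun p => by
      have h2 : Hit (_root_.shadow (slice V i (v i)) i B (c (v i)) ∪ slice W i (c (v i))) p ↔
          Hit (_root_.shadow (slice V i (v i)) i B (c (v i))) p ∨ Hit (slice W i (c (v i))) p := by
        simp only [Hit, Finset.mem_union, or_and_right, exists_or]
      rw [h2, hsh, hit_slice, hit_slice, (hhit p).1, and_or_left]
  have h2 : Function.update v i (c (v i)) ∈ slice V i (c (v i)) := by
    rw [← h1]
    exact Finset.mem_union_left _ (mem_shadow.2 ⟨v, mem_slice.2 ⟨hv, rfl⟩, hB, rfl⟩)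
  exact hV.noTwin v hv _ (mem_slice.1 h2).1 ⟨i, by simp, fun n hn => by simp [hn]⟩

theorem RigidBelow.false_of_compl_notMem [Finite S] (hc : IsComplementation c) {n : ℕ}
    (ih : RigidBelow c d n) (hn : V.card = n) (hV : TwinFreeCode c V) (hW : TwinFreeCode c W)
    (h : SameRegion c V W) (hdisj : ∀ w, w ∈ V → w ∈ W → False) {v u : Fin d → S} (hv : v ∈ V)
    (hu : u ∈ V) (huv : u i ≠ v i) (hVv : ∀ w ∈ V, w i ≠ c (v i)) : False := by
  have hWv : ∀ w ∈ W, w i ≠ c (v i) := fun w hw hwi =>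
    ih.false_of_letter_notMem hc (h.card_eq hc hV.code hW.code ▸ hn) hW hV.code h.symm hw
      fun x hx => hwi ▸ hVv x hx
  have h1 := ih (slice V i (v i)) (slice W i (v i))
    (by
      rw [← hn]
      exact Finset.card_lt_card ⟨slice_subset _ _ _, fun h1 => huv (mem_slice.1 (h1 hu)).2⟩)
    (hV.mono (slice_subset _ _ _)) (hW.mono (slice_subset _ _ _)).code fun p => by
      obtain ⟨P, Q, h1, h2, h3, h4, h5, h6⟩ := h.hitAt hc hV.code hW.code i (v i) p
      have h7 : ¬ HitAt W i (c (v i)) p := fun ⟨w, hw, hwi, _⟩ => hWv w hw hwi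
      have h8 : ¬ HitAt V i (c (v i)) p := fun ⟨w, hw, hwi, _⟩ => hVv w hw hwi
      rw [hit_slice, hit_slice]
      tauto
  exact hdisj v hv (slice_subset W i (v i) (h1 ▸ mem_slice.2 ⟨hv, rfl⟩))

theorem TwinFreeCode.five_le_slice [Finite S] (hc : IsComplementation c) (hV : TwinFreeCode c V)
    (h : SameRegion c V W) (hdisj : ∀ w, w ∈ V → w ∈ W → False)
    (hsh : shadow W i B g = shadow V i B g) {x : Fin d → S} (hx : x ∈ V)
    (hxB : x i ∈ (B : Set S)) : 5 ≤ (slice V i (c (x i))).card := by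
  obtain ⟨w, hw, hwB, hwx⟩ := mem_shadow.1 (hsh.symm ▸ mem_shadow.2 ⟨x, hx, hxB, rfl⟩ :
    Function.update x i g ∈ shadow W i B g)
  have hwn : ∀ n, n ≠ i → w n = x n := fun n hn => by simpa [hn] using congrFun hwx n
  have hne : x i ≠ w i := fun h1 => hdisj x hx (by
    convert hw using 1
    funext n
    by_cases hn : n = i
    · rw [hn, h1]
    · rw [hwn n hn])
  have hcov : ∀ p : Pt c d, InBox w p → Hit (sec c V w i (c (x i))) p := fun p hp =>
    (hit_sec hp).2 ((hc.hitAt_compl_of_cover hV.code (fun p hp => (h p).2 ⟨w, hw, hp⟩) hne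
      (ne_of_mem hwB hxB) hp).1 ⟨x, hx, rfl, fun n hn => hwn n hn ▸ hp n⟩)
  have hmem : w ∈ sec c V w i (x i) := by
    refine mem_sec.2 ⟨rfl, ?_, hc.compat_self w⟩
    convert hx using 1
    funext n
    by_cases hn : n = i
    · rw [hn, Function.update_self]
    · rw [Function.update_of_ne hn, hwn n hn]
  rcases hc.cover_five (hV.twinFree_sec hc w i (c (x i))) hcov with h1 | h1
  · exact (hV.sec_disjoint hmem h1).elim
  · exact h1.trans (sec_card_le c V w i (c (x i)))

theorem exists_shadow_twin (hc : IsComplementation c) (hV : TwinFreeCode c V)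
    (hsh : ¬ TwinFreeCode c (shadow V i B g)) : ∃ v₁ ∈ V, ∃ v₂ ∈ V, ∃ j, v₁ i ∈ (B : Set S) ∧
      v₂ i ∈ (B : Set S) ∧ v₂ i ≠ v₁ i ∧ j ≠ i ∧ v₂ j = c (v₁ j) ∧
      ∀ n, n ≠ i → n ≠ j → v₂ n = v₁ n := by
  by_contra! hcon
  refine hsh ⟨polyboxCode_shadow hV.code, fun x hx y hy ⟨j, hj, hoff⟩ => ?_⟩
  obtain ⟨u, hu, huB, rfl⟩ := mem_shadow.1 hx
  obtain ⟨v, hv, hvB, rfl⟩ := mem_shadow.1 hy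
  have hji : j ≠ i := by
    rintro rfl
    simp only [Function.update_self] at hj
    exact hc.ne _ hj.symm
  have hj' : v j = c (u j) := by simpa [hji] using hj
  have hoff' : ∀ n, n ≠ i → n ≠ j → v n = u n := fun n h1 h2 => by simpa [h1] using hoff n h2
  by_cases hi : v i = u i
  · refine hV.noTwin u hu v hv ⟨j, hj', fun n hn => ?_⟩
    by_cases hni : n = i
    · rw [hni, hi]
    · exact hoff' n hni hn
  · obtain ⟨n, h1, h2, h3⟩ := hcon u hu v hv j huB hvB hi hji hj'
    exact h3 (hoff' n h1 h2)

theorem RigidBelow.false_of_two_pairs [Finite S] (hc : IsComplementation c) {n : ℕ}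
    (ih : RigidBelow c d n) (hn : V.card = n) (h5 : 5 ≤ n) (h9 : n ≤ 9) (hV : TwinFreeCode c V)
    (hW : TwinFreeCode c W) (h : SameRegion c V W) (hdisj : ∀ w, w ∈ V → w ∈ W → False)
    (hcl : ∀ v ∈ V, ∃ u ∈ V, u i = c (v i)) {s t : S} (hs : ∃ v ∈ V, v i = s)
    (ht : ∃ v ∈ V, v i = t) (hts : t ≠ s) (hts' : t ≠ c s) : False := by
  classical
  have hWn : W.card = n := h.card_eq hc hV.code hW.code ▸ hn
  obtain ⟨B, hB⟩ : ∃ B : ESet c, (V.filter fun w => w i ∈ (B : Set S)).card ≤ 4 := by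
    obtain ⟨B, -⟩ := hc.exists_mem_letter s
    obtain ⟨B', hB'⟩ := exists_compl B
    have h1 := Finset.card_filter_add_card_filter_not (s := V) fun w => w i ∈ (B : Set S)
    by_cases h2 : (V.filter fun w => w i ∈ (B : Set S)).card ≤ 4
    · exact ⟨B, h2⟩
    · refine ⟨B', ?_⟩
      simp only [hB']
      omega
  have hlet : ∀ {s}, (∃ v ∈ V, v i = s) → ∃ v ∈ V, v i ∈ (B : Set S) ∧ (v i = s ∨ v i = c s) := by
    rintro s ⟨v, hv, rfl⟩
    by_cases h1 : v i ∈ (B : Set S)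
    · exact ⟨v, hv, h1, Or.inl rfl⟩
    · obtain ⟨u, hu, hui⟩ := hcl v hv
      exact ⟨u, hu, hui ▸ compl_mem B h1, Or.inr hui⟩
  have hsh : ¬ TwinFreeCode c (shadow V i B s) := fun hsh => by
    have h1 := ih _ _ (by rw [card_shadow hc hV.code]; omega) hsh
      (polyboxCode_shadow hW.code) h.shadow
    obtain ⟨x, hx, hxB, hxs⟩ := hlet hs
    obtain ⟨y, hy, hyB, hyt⟩ := hlet ht
    have h2 := hV.five_le_slice hc h hdisj h1 hx hxB
    have h3 := hV.five_le_slice hc h hdisj h1 hy hyB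
    have hxy : c (x i) ≠ c (y i) := fun hxy => by
      have hxy := hc.inj hxy
      rcases hxs with hxs | hxs <;> rcases hyt with hyt | hyt
      · exact hts (by rw [← hxs, ← hyt, hxy])
      · exact hts' (by rw [← hxs, hxy, hyt, hc.invol])
      · exact hts' (by rw [← hxs, ← hyt, hxy])
      · exact hts (hc.inj (by rw [← hxs, ← hyt, hxy]))
    have h4 := sum_slice_le V i [c (x i), c (y i)] (by simpa using hxy)
    simp only [List.map_cons, List.map_nil, List.sum_cons, List.sum_nil] at h4
    omega
  obtain ⟨v₁, hv₁, v₂, hv₂, j, hB₁, hB₂, hne, hji, hj, hoff⟩ := exists_shadow_twin hc hV hsh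
  have hpos : ∀ v ∈ V, 0 < (slice W i (v i)).card := fun v hv => by
    by_contra h0
    refine ih.false_of_letter_notMem (i := i) hc hn hV hW.code h hv fun w hw hwi => h0 ?_
    exact Finset.card_pos.2 ⟨w, mem_slice.2 ⟨hw, hwi⟩⟩
  have hpos' : ∀ v ∈ V, 0 < (slice W i (c (v i))).card := fun v hv => by
    obtain ⟨u, hu, hui⟩ := hcl v hv
    exact hui ▸ hpos u hu
  refine TwinShadow.false hc (V := V) (W := W) (i := i) (j := j) (B := B) (v₁ := v₁) (v₂ := v₂)
    ⟨hV, hW, h, by omega, by omega, hdisj, fun l hl hlB => ?_, hv₁, hv₂, hB₁, hB₂, hne, hji, hj,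
      hoff, hpos v₁ hv₁, hpos' v₁ hv₁, hpos v₂ hv₂, hpos' v₂ hv₂⟩
  have h1 : (W.filter fun w => w i ∈ (B : Set S)).card ≤ 4 := by
    rw [← card_shadow (g := s) hc hW.code, ← (h.shadow (i := i) (B := B) (g := s)).card_eq hc
      (polyboxCode_shadow hV.code) (polyboxCode_shadow hW.code), card_shadow hc hV.code]
    exact hB
  refine le_trans (List.sum_le_sum fun s hs => ?_) ((sum_slice_le _ i l hl).trans h1)
  refine Finset.card_le_card fun w hw => ?_
  have hw := mem_slice.1 hw
  exact mem_slice.2 ⟨Finset.mem_filter.2 ⟨hw.1, hw.2 ▸ hlB s hs⟩, hw.2⟩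

theorem RigidBelow.eq [Finite S] (hc : IsComplementation c) {n : ℕ}
    (ih : RigidBelow c d n) (hn : V.card = n) (h9 : n ≤ 9) (hV : TwinFreeCode c V)
    (hW : PolyboxCode c (W : Set (Fin d → S))) (h : SameRegion c V W) : W = V := by
  by_contra hne
  have hW' : TwinFreeCode c W := ih.twinFree hc hn h9 hV hW h
  have hdisj : ∀ w, w ∈ V → w ∈ W → False := fun w h1 h2 => ih.disjoint hn hV hW h hne h1 h2
  have hcard := h.card_eq hc hV.code hW
  obtain ⟨w, hw⟩ : W.Nonempty := by
    rw [Finset.nonempty_iff_ne_empty]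
    rintro rfl
    exact hne (Finset.card_eq_zero.1 (by simpa using hcard)).symm
  have h5 : 5 ≤ V.card := (hc.cover_five hV fun p hp => (h p).2 ⟨w, hw, hp⟩).resolve_left
    fun h1 => hdisj w h1 hw
  obtain ⟨v, hv, u, hu, hvu⟩ := Finset.one_lt_card.1 (by omega : 1 < V.card)
  obtain ⟨i, hi⟩ := hV.code v hv u hu hvu
  have hcl : ∀ x ∈ V, ∃ y ∈ V, y i = c (x i) := fun x hx => by
    by_contra! hcon
    by_cases hxv : v i = x i
    · exact hcon u hu (by rw [hi, hxv])
    · exact ih.false_of_compl_notMem hc hn hV hW' h hdisj hx hv hxv hcon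
  obtain ⟨x, hx, hxv, hxv'⟩ : ∃ x ∈ V, x i ≠ v i ∧ x i ≠ c (v i) := by
    by_contra! hcon
    have hWl : ∀ w ∈ W, w i ≠ v i → w i = c (v i) := fun w hw h1 => by
      by_contra h2
      refine ih.false_of_letter_notMem (i := i) hc (hcard ▸ hn) hW' hV.code h.symm hw
        fun y hy hyw => ?_
      exact h2 (hyw ▸ hcon y hy (hyw ▸ h1))
    have hsl : ∀ {K : Finset (Fin d → S)} {p : Pt c d}, (∀ w ∈ K, w i ≠ v i → w i = c (v i)) →
        (Hit (slice K i (v i)) p ↔ v i ∈ (p i : Set S) ∧ Hit K p) := by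
      refine fun hK => ⟨fun ⟨y, hy, hyp⟩ => ?_, fun ⟨hp, y, hy, hyp⟩ => ⟨y, ?_, hyp⟩⟩
      · have hy := mem_slice.1 hy
        exact ⟨hy.2 ▸ hyp i, y, hy.1, hyp⟩
      · refine mem_slice.2 ⟨hy, ?_⟩
        by_contra h1
        exact compl_notMem _ hp (hK y hy h1 ▸ hyp i)
    have h1 := ih (slice V i (v i)) (slice W i (v i))
      (by
        rw [← hn]
        refine Finset.card_lt_card ⟨slice_subset _ _ _, fun h1 => ?_⟩
        exact hc.ne _ (hi.symm.trans (mem_slice.1 (h1 hu)).2))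
      (hV.mono (slice_subset _ _ _)) (hW'.mono (slice_subset _ _ _)).code fun p => by
        rw [hsl hcon, hsl hWl, h]
    exact hdisj v hv (slice_subset W i (v i) (h1 ▸ mem_slice.2 ⟨hv, rfl⟩))
  exact ih.false_of_two_pairs hc hn (hn ▸ h5) h9 hV hW' h hdisj hcl ⟨v, hv, rfl⟩ ⟨x, hx, rfl⟩ hxv
    hxv'

theorem IsComplementation.rigidBelow [Finite S] (hc : IsComplementation c) {n : ℕ} (h : n ≤ 10) :
    RigidBelow c d n := by
  induction n with
  | zero => exact fun V W hV => absurd hV (Nat.not_lt_zero _)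
  | succ n ih =>
    intro V W hlt hV hW hVW
    have ih := ih (by omega)
    rcases (Nat.lt_succ_iff.1 hlt).lt_or_eq with h1 | h1
    · exact ih V W h1 hV hW hVW
    · exact ih.eq hc h1 (by omega) hV hW hVW

end Rigidity

theorem hit_iff_mem_realizeSet {d : ℕ} {c : S → S} {K : Finset (Fin d → S)} {p : Pt c d} :
    Hit K p ↔ (fun i => (p i : Set S)) ∈ RealizeSet c (K : Set (Fin d → S)) := by
  simp [Hit, InBox, RealizeSet, Realize, ELetter]

theorem rigid_of_card_le_nine {d : ℕ} [Fintype S] (c : S → S)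
    (hinv : Function.Involutive c) (hfix : ∀ s, c s ≠ s)
    (V : Set (Fin d → S)) (hV : PolyboxCode c V)
    (hVt : NoTwinPair c V) (hcard : V.ncard ≤ 9) :
    ∀ W : Set (Fin d → S), PolyboxCode c W → EquivCodes c V W → W = V := by
  intro W hW h
  have hc : IsComplementation c := ⟨hinv, hfix⟩
  obtain ⟨V, rfl⟩ := V.toFinite.exists_finset_coe
  obtain ⟨W, rfl⟩ := W.toFinite.exists_finset_coe
  rw [Set.ncard_coe_finset] at hcard
  rw [hc.rigidBelow le_rfl V W (by omega) ⟨hV, hVt⟩ hW fun p => by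
    rw [hit_iff_mem_realizeSet, hit_iff_mem_realizeSet, show RealizeSet c _ = _ from h]]
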